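/- arXiv:1207.6141 — 2 statements merged into one kernel-verified Lean document; each statement's English description precedes it below -/
import Mathlib

section
/- If H is a connected graph that contains two odd cycles, each of length at least 5, sharing at most one vertex, then H is not rooted-contractible. -/
open SimpleGraph

/-- An `H`-scheme in `G`, where the embedding `f` identifies the vertices of `H`
with vertices of `G`.  It is a collection of paths `P_{uv}` in `G`, one for each
edge `uv` of `H`, such that `P_{uv}` is a `u,v`-path meeting `V(H)` exactly in
`{u, v}`, and any collection of edges of `H` whose paths share a common vertex
of `G` must have a common endpoint in `H`. -/
structure HScheme {α β : Type} (H : SimpleGraph α) (G : SimpleGraph β) (f : α ↪ β) where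
  path : ∀ u v, H.Adj u v → G.Walk (f u) (f v)
  path_symm : ∀ u v (h : H.Adj u v), path v u h.symm = (path u v h).reverse
  path_isPath : ∀ u v (h : H.Adj u v), (path u v h).IsPath
  root_mem : ∀ u v (h : H.Adj u v) (w : α), f w ∈ (path u v h).support → w = u ∨ w = v
  common_endpoint : ∀ x : β,
    (∃ u v, ∃ h : H.Adj u v, x ∈ (path u v h).support) →
    ∃ z : α, ∀ u v (h : H.Adj u v), x ∈ (path u v h).support → z = u ∨ z = v

/-- `G` contains `H` as a rooted minor: pairwise disjoint connected branch sets
`C v ⊆ V(G)`, one for each vertex `v` of `H`, with `f v ∈ C v`, such that for every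
edge `uv` of `H` there is an edge of `G` between `C u` and `C v`. -/
def RootedMinor {α β : Type} (H : SimpleGraph α) (G : SimpleGraph β) (f : α ↪ β) : Prop :=
  ∃ C : α → Set β,
    (∀ v, f v ∈ C v) ∧
    (∀ v, (G.induce (C v)).Connected) ∧
    (Pairwise fun u v => Disjoint (C u) (C v)) ∧
    (∀ u v, H.Adj u v → ∃ x ∈ C u, ∃ y ∈ C v, G.Adj x y)

/-- `G` contains `H` as a minor: pairwise disjoint connected branch sets, one for each
vertex of `H`, such that for every edge `uv` of `H` there is an edge of `G` between the
corresponding branch sets. -/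
def HasMinor {β α : Type} (G : SimpleGraph β) (H : SimpleGraph α) : Prop :=
  ∃ C : α → Set β,
    (∀ v, (G.induce (C v)).Connected) ∧
    (Pairwise fun u v => Disjoint (C u) (C v)) ∧
    (∀ u v, H.Adj u v → ∃ x ∈ C u, ∃ y ∈ C v, G.Adj x y)

/-- `H` is rooted-contractible: every (finite) graph `G` containing an `H`-scheme
contains `H` as a rooted minor. -/
def IsRootedContractible {α : Type} (H : SimpleGraph α) : Prop :=
  ∀ (β : Type) [Fintype β] (G : SimpleGraph β) (f : α ↪ β),
    Nonempty (HScheme H G f) → RootedMinor H G f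

/-- `H` is weakly rooted-contractible: every (finite) graph `G` containing an
`H`-scheme contains `H` as a minor. -/
def IsWeaklyRootedContractible {α : Type} (H : SimpleGraph α) : Prop :=
  ∀ (β : Type) [Fintype β] (G : SimpleGraph β) (f : α ↪ β),
    Nonempty (HScheme H G f) → HasMinor G H

/-- The graph on two copies of `α`, roots `inl` and shadows `inr`, in which every edge `uv` of the
subgraph `F` of `H` is replaced by edges joining the shadow of each end to the root and to the
shadow of the other end. -/
def shadowGraph {α : Type} (H F : SimpleGraph α) : SimpleGraph (α ⊕ α) where
  Adj
    | .inl u, .inl v => H.Adj u v ∧ ¬ F.Adj u v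
    | .inl u, .inr v => F.Adj u v
    | .inr u, .inl v => F.Adj u v
    | .inr u, .inr v => F.Adj u v
  symm := ⟨by
    rintro (u | u) (v | v) h
    · exact ⟨h.1.symm, fun h' => h.2 h'.symm⟩
    all_goals exact SimpleGraph.Adj.symm h⟩
  loopless := ⟨by
    rintro (u | u) h
    · exact H.loopless.irrefl _ h.1
    · exact F.loopless.irrefl _ h⟩

open Classical in
/-- The path of the canonical scheme in the shadow graph that belongs to an edge. -/
noncomputable def shadowPath {α : Type} (H F : SimpleGraph α) (u v : α) (h : H.Adj u v) :
    (shadowGraph H F).Walk (.inl u) (.inl v) :=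
  if hF : F.Adj u v then
    .cons (show (shadowGraph H F).Adj (.inl u) (.inr v) from hF)
      (.cons (show (shadowGraph H F).Adj (.inr v) (.inr u) from hF.symm)
        (.cons (show (shadowGraph H F).Adj (.inr u) (.inl v) from hF) .nil))
  else .cons (show (shadowGraph H F).Adj (.inl u) (.inl v) from ⟨h, hF⟩) .nil

theorem mem_support_shadowPath {α : Type} {H F : SimpleGraph α} {u v : α} {h : H.Adj u v}
    {x : α ⊕ α} (hx : x ∈ (shadowPath H F u v h).support) :
    x.elim id id = u ∨ x.elim id id = v := by
  unfold shadowPath at hx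
  split_ifs at hx <;> simp at hx <;> aesop

theorem isPath_shadowPath {α : Type} {H F : SimpleGraph α} {u v : α} (h : H.Adj u v) :
    (shadowPath H F u v h).IsPath := by
  have huv := h.ne
  unfold shadowPath
  split_ifs <;> simp [huv, huv.symm]

theorem nonempty_hScheme_shadowGraph {α : Type} (H F : SimpleGraph α) :
    Nonempty (HScheme H (shadowGraph H F) Function.Embedding.inl) := by
  refine ⟨⟨shadowPath H F, ?_, ?_, ?_, ?_⟩⟩
  · intro u v h
    by_cases hF : F.Adj u v
    · simp only [shadowPath, hF, hF.symm, dif_pos]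
      rfl
    · have hF' : ¬ F.Adj v u := fun h' => hF h'.symm
      simp only [shadowPath, hF, hF', dif_neg, not_false_eq_true]
      rfl
  · intro u v h
    exact isPath_shadowPath h
  · intro u v h w hw
    exact mem_support_shadowPath hw
  · intro x _
    exact ⟨x.elim id id, fun u v h hx => mem_support_shadowPath hx⟩

/-- The trace on the shadows of a rooted minor model of `F` in its shadow graph: `w ∈ Y v` when the
shadow of `w` lies in the branch set of `v`. -/
structure IsShadowModel {α : Type} (F : SimpleGraph α) (Y : α → Set α) : Prop where
  eq_of_mem : ∀ {u v w}, w ∈ Y u → w ∈ Y v → u = v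
  exists_boundary : ∀ {v w} (S : Set α), w ∈ Y v → w ∈ S →
    ∃ x ∈ Y v, x ∈ S ∧ (F.Adj v x ∨ ∃ y ∈ Y v, y ∉ S ∧ F.Adj x y)
  exists_adj : ∀ {u v}, F.Adj u v →
    (∃ w ∈ Y v, F.Adj u w) ∨ (∃ w ∈ Y u, F.Adj v w) ∨ ∃ w ∈ Y u, ∃ x ∈ Y v, F.Adj w x

theorem RootedMinor.exists_isShadowModel {α : Type} {H F : SimpleGraph α} (hle : F ≤ H)
    (h : RootedMinor H (shadowGraph H F) Function.Embedding.inl) :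
    ∃ Y : α → Set α, IsShadowModel F Y := by
  obtain ⟨C, hroot, hconn, hdisj, hadj⟩ := h
  have huniq : ∀ {u v x}, x ∈ C u → x ∈ C v → u = v := by
    intro u v x hu hv
    by_contra hne
    exact Set.disjoint_left.1 (hdisj hne) hu hv
  have hrt : ∀ {u v}, Sum.inl u ∈ C v → u = v := fun hu => huniq (hroot _) hu
  refine ⟨fun v => {w | Sum.inr w ∈ C v}, fun hu hv => huniq hu hv, ?_, ?_⟩
  · intro v w S hw hS
    obtain ⟨p⟩ := (hconn v).preconnected ⟨.inr w, hw⟩ ⟨.inl v, hroot v⟩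
    obtain ⟨⟨⟨⟨x, hx⟩, ⟨y, hy⟩⟩, hxy⟩, -, hxS, hyS⟩ :=
      p.exists_boundary_dart {z | ∃ s ∈ S, z.1 = .inr s} ⟨w, hS, rfl⟩ (by simp)
    obtain ⟨s, hs, rfl : x = _⟩ := hxS
    refine ⟨s, hx, hs, ?_⟩
    rcases y with y | y
    · obtain rfl := hrt hy
      exact Or.inl (SimpleGraph.Adj.symm (G := F) hxy)
    · exact Or.inr ⟨y, hy, fun h' => hyS ⟨y, h', rfl⟩, hxy⟩
  · intro u v huv
    obtain ⟨x, hx, y, hy, hxy⟩ := hadj u v (hle huv)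
    rcases x with x | x <;> rcases y with y | y
    · obtain rfl := hrt hx
      obtain rfl := hrt hy
      exact absurd huv hxy.2
    · obtain rfl := hrt hx
      exact Or.inl ⟨y, hy, hxy⟩
    · obtain rfl := hrt hy
      exact Or.inr (Or.inl ⟨x, hx, SimpleGraph.Adj.symm (G := F) hxy⟩)
    · exact Or.inr (Or.inr ⟨x, hx, y, hy, hxy⟩)

/-- A set `B` of vertices attached to the rest of the graph at `r` either uses the shadow of `r`,
or forces the branch set of `r` to contain that shadow but no shadow of a vertex in `B`. -/
def Demands {α : Type} (Y : α → Set α) (B : Set α) (r : α) : Prop :=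
  (∃ b ∈ B, r ∈ Y b) ∨ (r ∈ Y r ∧ ∀ b ∈ B, b ∉ Y r)

theorem not_demands_of_demands {α : Type} {F : SimpleGraph α} {Y : α → Set α}
    (hY : IsShadowModel F Y) {B₁ B₂ : Set α} {r : α} (hdisj : Disjoint B₁ B₂)
    (h₁ : r ∉ B₁) (h₂ : r ∉ B₂) (hN : ∀ x, F.Adj r x → x ∈ B₁ ∨ x ∈ B₂)
    (hD : Demands Y B₁ r) : ¬ Demands Y B₂ r := by
  rintro (⟨b, hb, hrb⟩ | ⟨hr, hB₂⟩) <;> rcases hD with ⟨c, hc, hrc⟩ | ⟨hr', hB₁⟩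
  · exact Set.disjoint_left.1 hdisj hc (hY.eq_of_mem hrb hrc ▸ hb)
  · exact h₂ (hY.eq_of_mem hrb hr' ▸ hb)
  · exact h₁ (hY.eq_of_mem hrc hr ▸ hc)
  · obtain ⟨x, hx, -, h | ⟨y, -, hy, -⟩⟩ := hY.exists_boundary Set.univ hr trivial
    · exact (hN x h).elim (fun h => hB₁ x h hx) (fun h => hB₂ x h hx)
    · exact hy trivial

theorem Demands.step {α : Type} {F : SimpleGraph α} {Y : α → Set α}
    (hY : IsShadowModel F Y) {B : Set α} {r s : α} (hr : r ∉ B) (hs : s ∉ B) (hrs : F.Adj r s)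
    (hB : ∀ b ∈ B, ∀ x, F.Adj b x → x ∈ B ∨ x = r) (hN : ∀ x, F.Adj r x → x ∈ B ∨ x = s)
    (hD : Demands Y B r) : Demands Y (insert r B) s := by
  rcases hD with ⟨b, hb, hrb⟩ | ⟨hr', hBr⟩
  · by_contra hcon
    simp only [Demands, not_or, not_and, not_exists] at hcon
    obtain ⟨h1, h2⟩ := hcon
    have hrs' : r ∉ Y s := fun h => hs (hY.eq_of_mem hrb h ▸ hb)
    have hrr : r ∉ Y r := fun h => hr (hY.eq_of_mem hrb h ▸ hb)
    have hsr : s ∉ Y r := h1 r (by simp)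
    have hBs : ∀ b ∈ B, b ∉ Y s := by
      intro c hc hcs
      obtain ⟨x, hx, hxB, h | ⟨y, hy, hyB, hxy⟩⟩ := hY.exists_boundary B hcs hc
      · exact (hB x hxB s h.symm).elim hs hrs.ne'
      · rcases hB x hxB y hxy with h | rfl
        · exact hyB h
        · exact hrs' hy
    have hss : s ∉ Y s := fun h => h2 h fun c hc => by
      rcases hc with rfl | hc
      · exact hrs'
      · exact hBs c hc
    have hYr : ∀ x ∈ Y r, x ∈ B := by
      intro c hc
      by_contra hcB
      obtain ⟨x, hx, hxB, h | ⟨y, hy, hyB, hxy⟩⟩ := hY.exists_boundary Bᶜ hc hcB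
      · rcases hN x h with h | rfl
        · exact hxB h
        · exact hsr hx
      · rcases hB y (not_not.1 hyB) x hxy.symm with h | rfl
        · exact hxB h
        · exact hrr hx
    rcases hY.exists_adj hrs with ⟨w, hw, h⟩ | ⟨w, hw, h⟩ | ⟨w, hw, x, hx, h⟩
    · rcases hN w h with h | rfl
      · exact hBs w h hw
      · exact hss hw
    · exact (hB w (hYr w hw) s h.symm).elim hs hrs.ne'
    · rcases hB w (hYr w hw) x h with h | rfl
      · exact hBs x h hx
      · exact hrs' hx
  · obtain ⟨x, hx, -, h | ⟨y, -, hy, -⟩⟩ := hY.exists_boundary Set.univ hr' trivial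
    · rcases hN x h with h | rfl
      · exact absurd hx (hBr x h)
      · exact Or.inl ⟨r, by simp, hx⟩
    · exact absurd trivial hy

theorem two_mul_le_sum_Ico {a : ℕ → ℕ} {s : ℕ} (k : ℕ)
    (h : ∀ i, s ≤ i → i + 1 < s + 2 * k → 2 ≤ a i + a (i + 1)) :
    2 * k ≤ ∑ i ∈ Finset.Ico s (s + 2 * k), a i := by
  induction k with
  | zero => simp
  | succ k ih =>
    have h1 := ih fun i hi hi' => h i hi (by omega)
    have h2 := h (s + 2 * k) (by omega) (by omega)
    rw [show s + 2 * (k + 1) = s + 2 * k + 1 + 1 by ring, Finset.sum_Ico_succ_top (by omega),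
      Finset.sum_Ico_succ_top (by omega)]
    omega

theorem IsShadowModel.demands_of_cycle {α : Type} {F : SimpleGraph α} {Y : α → Set α}
    (hY : IsShadowModel F Y) {r : α} {q : ℕ → α} {k : ℕ} (hk : 1 < k)
    (h0 : q 0 = r) (hend : q (2 * k + 1) = r)
    (hinj : Set.InjOn q (Set.Icc 1 (2 * k + 1)))
    (hadj : ∀ i ≤ 2 * k, F.Adj (q i) (q (i + 1)))
    (hN : ∀ i, 1 ≤ i → i ≤ 2 * k → ∀ x, F.Adj (q i) x → x = q (i - 1) ∨ x = q (i + 1)) :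
    Demands Y (q '' Set.Icc 1 (2 * k)) r := by
  classical
  by_contra hcon
  simp only [Demands, not_or, not_exists, not_and] at hcon
  obtain ⟨hK1, hK2⟩ := hcon
  replace hK1 : ∀ i, 1 ≤ i → i ≤ 2 * k → r ∉ Y (q i) := fun i h1 h2 => hK1 _ ⟨i, ⟨h1, h2⟩, rfl⟩
  have hinj' : ∀ {i j}, 1 ≤ i → i ≤ 2 * k + 1 → 1 ≤ j → j ≤ 2 * k + 1 → q i = q j → i = j :=
    fun h1 h2 h3 h4 h => hinj ⟨h1, h2⟩ ⟨h3, h4⟩ h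
  have hner : ∀ i, 1 ≤ i → i ≤ 2 * k → q i ≠ r := by
    intro i h1 h2 h
    have := hinj' h1 (by omega) (by omega) le_rfl (h.trans hend.symm)
    omega
  have hN' : ∀ i, 1 ≤ i → i ≤ 2 * k → ∀ x, F.Adj (q i) x → x ≠ r →
      ∃ j, 1 ≤ j ∧ j ≤ 2 * k ∧ x = q j ∧ (j + 1 = i ∨ j = i + 1) := by
    intro i h1 h2 x hx hxr
    rcases hN i h1 h2 x hx with rfl | rfl
    · refine ⟨i - 1, ?_, by omega, rfl, by omega⟩
      rcases Nat.eq_or_lt_of_le h1 with rfl | h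
      · exact absurd h0 hxr
      · omega
    · refine ⟨i + 1, by omega, ?_, rfl, by omega⟩
      rcases Nat.eq_or_lt_of_le h2 with rfl | h
      · exact absurd hend hxr
      · omega
  have hNr : ∀ i, 1 ≤ i → i ≤ 2 * k → F.Adj (q i) r → i = 1 ∨ i = 2 * k := by
    intro i h1 h2 h
    by_contra hne
    rcases hN i h1 h2 r h with h | h
    · exact hner (i - 1) (by omega) (by omega) h.symm
    · exact hner (i + 1) (by omega) (by omega) h.symm
  have hconf : ∀ i, 1 ≤ i → i ≤ 2 * k → ∀ w ∈ Y (q i), ∃ j, 1 ≤ j ∧ j ≤ 2 * k ∧ w = q j := by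
    intro i h1 h2 w hw
    by_contra hwB
    obtain ⟨x, hx, hxB, h | ⟨y, hy, hyB, hxy⟩⟩ :=
      hY.exists_boundary {w | ¬ ∃ j, 1 ≤ j ∧ j ≤ 2 * k ∧ w = q j} hw hwB
    · obtain ⟨j, hj, hj', e, -⟩ := hN' i h1 h2 x h (fun e => hK1 i h1 h2 (e ▸ hx))
      exact hxB ⟨j, hj, hj', e⟩
    · obtain ⟨l, hl, hl', rfl⟩ := not_not.1 hyB
      obtain ⟨j, hj, hj', e, -⟩ := hN' l hl hl' x hxy.symm (fun e => hK1 i h1 h2 (e ▸ hx))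
      exact hxB ⟨j, hj, hj', e⟩
  set A : ℕ → Finset ℕ := fun i => (Finset.Ico 1 (1 + 2 * k)).filter fun j => q j ∈ Y (q i) with hA
  have hmemA : ∀ {i j}, j ∈ A i ↔ (1 ≤ j ∧ j ≤ 2 * k) ∧ q j ∈ Y (q i) := by
    intro i j
    simp only [hA, Finset.mem_filter, Finset.mem_Ico]
    constructor
    · rintro ⟨⟨h1, h2⟩, h3⟩; exact ⟨⟨h1, by omega⟩, h3⟩
    · rintro ⟨⟨h1, h2⟩, h3⟩; exact ⟨⟨h1, by omega⟩, h3⟩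
  have hAdisj : Set.PairwiseDisjoint (Finset.Ico 1 (1 + 2 * k) : Set ℕ) A := by
    intro i hi j hj hne
    simp only [Finset.coe_Ico, Set.mem_Ico] at hi hj
    refine Finset.disjoint_left.2 fun x hx hx' => hne ?_
    exact hinj' hi.1 (by omega) hj.1 (by omega)
      (hY.eq_of_mem (hmemA.1 hx).2 (hmemA.1 hx').2)
  have hsum : ∑ i ∈ Finset.Ico 1 (1 + 2 * k), (A i).card =
      ((Finset.Ico 1 (1 + 2 * k)).biUnion A).card := (Finset.card_biUnion hAdisj).symm
  have hsub : (Finset.Ico 1 (1 + 2 * k)).biUnion A ⊆ Finset.Ico 1 (1 + 2 * k) :=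
    Finset.biUnion_subset.2 fun i _ => Finset.filter_subset _ _
  have hle : ∑ i ∈ Finset.Ico 1 (1 + 2 * k), (A i).card ≤ 2 * k := by
    simpa [hsum] using Finset.card_le_card hsub
  have hnb : ∀ i, 1 ≤ i → i ≤ 2 * k → (A i).Nonempty → ∃ j ∈ A i, j + 1 = i ∨ j = i + 1 := by
    rintro i h1 h2 ⟨j, hj⟩
    obtain ⟨x, hx, -, h | ⟨y, -, hy, -⟩⟩ := hY.exists_boundary Set.univ (hmemA.1 hj).2 trivial
    · obtain ⟨l, hl, hl', rfl, e⟩ := hN' i h1 h2 x h (fun e => hK1 i h1 h2 (e ▸ hx))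
      exact ⟨l, hmemA.2 ⟨⟨hl, hl'⟩, hx⟩, e⟩
    · exact absurd trivial hy
  have htwo : ∀ {i j l}, j ∈ A i → l ∈ A i → j ≠ l → 2 ≤ (A i).card := fun hj hl hne =>
    Finset.one_lt_card.2 ⟨_, hj, _, hl, hne⟩
  have hpair : ∀ i, 1 ≤ i → i + 1 ≤ 2 * k → 2 ≤ (A i).card + (A (i + 1)).card := by
    intro i h1 h2
    rcases hY.exists_adj (hadj i (by omega)) with ⟨w, hw, h⟩ | ⟨w, hw, h⟩ | ⟨w, hw, x, hx, h⟩
    · obtain ⟨j, hj, hj', rfl, e⟩ :=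
        hN' i h1 (by omega) w h (fun e => hK1 (i + 1) (by omega) h2 (e ▸ hw))
      have hjA : j ∈ A (i + 1) := hmemA.2 ⟨⟨hj, hj'⟩, hw⟩
      obtain ⟨l, hlA, e'⟩ := hnb (i + 1) (by omega) h2 ⟨j, hjA⟩
      have := htwo hjA hlA (by omega)
      omega
    · obtain ⟨j, hj, hj', rfl, e⟩ :=
        hN' (i + 1) (by omega) h2 w h (fun e => hK1 i h1 (by omega) (e ▸ hw))
      have hjA : j ∈ A i := hmemA.2 ⟨⟨hj, hj'⟩, hw⟩
      obtain ⟨l, hlA, e'⟩ := hnb i h1 (by omega) ⟨j, hjA⟩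
      have := htwo hjA hlA (by omega)
      omega
    · obtain ⟨j, hj, hj', rfl⟩ := hconf i h1 (by omega) w hw
      obtain ⟨l, hl, hl', rfl⟩ := hconf (i + 1) (by omega) h2 x hx
      have e1 : 0 < (A i).card := Finset.card_pos.2 ⟨j, hmemA.2 ⟨⟨hj, hj'⟩, hw⟩⟩
      have e2 : 0 < (A (i + 1)).card := Finset.card_pos.2 ⟨l, hmemA.2 ⟨⟨hl, hl'⟩, hx⟩⟩
      omega
  have hge := two_mul_le_sum_Ico (a := fun i => (A i).card) (s := 1) k
    fun i hi hi' => hpair i hi (by omega)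
  have hnot : ∀ j, 1 ≤ j → j ≤ 2 * k → q j ∉ Y r := by
    intro j h1 h2 hj
    have heq : (Finset.Ico 1 (1 + 2 * k)).biUnion A = Finset.Ico 1 (1 + 2 * k) :=
      Finset.eq_of_subset_of_card_le hsub (by rw [← hsum]; simpa using hge)
    have : j ∈ (Finset.Ico 1 (1 + 2 * k)).biUnion A := by
      rw [heq]; simp; omega
    obtain ⟨i, hi, hji⟩ := Finset.mem_biUnion.1 this
    rw [Finset.mem_Ico] at hi
    exact hner i hi.1 (by omega) (hY.eq_of_mem (hmemA.1 hji).2 hj)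
  have hrr : r ∉ Y r := by
    refine fun h => hK2 h ?_
    rintro _ ⟨j, hj, rfl⟩
    exact hnot j hj.1 hj.2
  have hext : ∀ e, e = 1 ∨ e = 2 * k → F.Adj r (q e) → 2 ≤ (A e).card := by
    intro e he hre
    have h1 : 1 ≤ e := by omega
    have h2 : e ≤ 2 * k := by omega
    obtain ⟨j, hj, hj1⟩ : ∃ j ∈ A e, j = 1 ∨ j = 2 * k := by
      rcases hY.exists_adj hre with ⟨w, hw, h⟩ | ⟨w, hw, h⟩ | ⟨w, hw, x, hx, h⟩
      · obtain ⟨j, hj, hj', rfl⟩ := hconf e h1 h2 w hw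
        exact ⟨j, hmemA.2 ⟨⟨hj, hj'⟩, hw⟩, hNr j hj hj' h.symm⟩
      · obtain ⟨j, hj, hj', rfl, -⟩ := hN' e h1 h2 w h (fun e => hrr (e ▸ hw))
        exact absurd hw (hnot j hj hj')
      · obtain ⟨l, hl, hl', rfl⟩ := hconf e h1 h2 x hx
        obtain ⟨j, hj, hj', rfl, -⟩ := hN' l hl hl' w h.symm (fun e => hrr (e ▸ hw))
        exact absurd hw (hnot j hj hj')
    obtain ⟨l, hl, hl'⟩ := hnb e h1 h2 ⟨j, hj⟩
    exact htwo hj hl (by omega)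
  have hfirst := hext 1 (Or.inl rfl) (by simpa [h0] using hadj 0 (by omega))
  have hlast := hext (2 * k) (Or.inr rfl) (by simpa [hend] using (hadj (2 * k) le_rfl).symm)
  have hmid := two_mul_le_sum_Ico (a := fun i => (A i).card) (s := 2) (k - 1)
    fun i hi hi' => hpair i (by omega) (by omega)
  rw [show 1 + 2 * k = 2 * k + 1 by ring, Finset.sum_Ico_succ_top (by omega),
    Finset.sum_eq_sum_Ico_succ_bot (by omega)] at hle
  rw [show 2 + 2 * (k - 1) = 2 * k by omega] at hmid
  simp only [Nat.reduceAdd] at hle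
  omega

theorem IsShadowModel.demands_of_isCycle {α : Type} {H F : SimpleGraph α} {Y : α → Set α}
    (hY : IsShadowModel F Y) {a : α} {c : H.Walk a a} (hc : c.IsCycle) (hodd : Odd c.length)
    (hlen : 5 ≤ c.length) (hF : ∀ x y, s(x, y) ∈ c.edges → F.Adj x y)
    (hN : ∀ x ∈ c.support, x ≠ a → ∀ y, F.Adj x y → s(x, y) ∈ c.edges) :
    Demands Y {x | x ∈ c.support ∧ x ≠ a} a := by
  obtain ⟨k, hk⟩ := hodd
  have hend : c.getVert (2 * k + 1) = a := hk ▸ c.getVert_length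
  have hinj : Set.InjOn c.getVert (Set.Icc 1 (2 * k + 1)) := hk ▸ hc.getVert_injOn
  have hne : ∀ i, 1 ≤ i → i ≤ 2 * k → c.getVert i ≠ a := by
    intro i h1 h2 h
    have := hinj ⟨h1, by omega⟩ ⟨by omega, le_rfl⟩ (h.trans hend.symm)
    omega
  have hB : {x | x ∈ c.support ∧ x ≠ a} = c.getVert '' Set.Icc 1 (2 * k) := by
    ext x
    constructor
    · rintro ⟨hx, hxa⟩
      obtain ⟨i, rfl, hi⟩ := Walk.mem_support_iff_exists_getVert.1 hx
      have h0 : i ≠ 0 := by rintro rfl; exact hxa c.getVert_zero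
      have h1 : i ≠ 2 * k + 1 := by rintro rfl; exact hxa hend
      exact ⟨i, ⟨by omega, by omega⟩, rfl⟩
    · rintro ⟨i, hi, rfl⟩
      exact ⟨c.getVert_mem_support i, hne i hi.1 hi.2⟩
  rw [hB]
  refine hY.demands_of_cycle (by omega) c.getVert_zero hend hinj ?_ ?_
  · intro i hi
    exact hF _ _ (c.mk_mem_edges_iff_exists.2 ⟨i, by omega, rfl⟩)
  · intro i h1 h2 x hx
    obtain ⟨j, hj, e⟩ :=
      c.mk_mem_edges_iff_exists.1 (hN _ (c.getVert_mem_support i) (hne i h1 h2) x hx)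
    rcases Sym2.eq_iff.1 e with ⟨e1, e2⟩ | ⟨e1, e2⟩
    · have hj0 : j ≠ 0 := by
        rintro rfl
        exact hne i h1 h2 (e1.symm.trans c.getVert_zero)
      have := hinj ⟨by omega, by omega⟩ ⟨h1, by omega⟩ e1
      exact Or.inr (this ▸ e2.symm)
    · have := hinj ⟨by omega, by omega⟩ ⟨h1, by omega⟩ e2
      exact Or.inl (by rw [← e1, ← this]; rfl)

theorem not_isRootedContractible_of_linked_cycles {α : Type} [Fintype α] {H : SimpleGraph α}
    {a b : α} {c₁ : H.Walk a a} {c₂ : H.Walk b b} {p : H.Walk a b}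
    (hc₁ : c₁.IsCycle) (hc₂ : c₂.IsCycle) (hp : p.IsPath)
    (hodd₁ : Odd c₁.length) (hodd₂ : Odd c₂.length)
    (hlen₁ : 5 ≤ c₁.length) (hlen₂ : 5 ≤ c₂.length)
    (h₁ : ∀ x ∈ c₁.support, x ∈ p.support → x = a)
    (h₂ : ∀ x ∈ c₂.support, x ∈ p.support → x = b)
    (h₁₂ : ∀ x ∈ c₁.support, x ∈ c₂.support → x = a ∧ x = b) :
    ¬ IsRootedContractible H := by
  intro hH
  set F : SimpleGraph α := c₁.toSubgraph.spanningCoe ⊔ c₂.toSubgraph.spanningCoe ⊔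
    p.toSubgraph.spanningCoe with hFdef
  have hF : ∀ {x y}, F.Adj x y ↔ s(x, y) ∈ c₁.edges ∨ s(x, y) ∈ c₂.edges ∨ s(x, y) ∈ p.edges := by
    intro x y
    simp [hFdef, Walk.adj_toSubgraph_iff_mem_edges, or_assoc]
  have hle : F ≤ H := by
    intro x y h
    rcases hF.1 h with h | h | h <;> exact Walk.adj_of_mem_edges _ h
  obtain ⟨Y, hY⟩ := RootedMinor.exists_isShadowModel hle
    (hH (α ⊕ α) _ _ (nonempty_hScheme_shadowGraph H F))
  have hD₁ : Demands Y {x | x ∈ c₁.support ∧ x ≠ a} a := by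
    refine hY.demands_of_isCycle hc₁ hodd₁ hlen₁ (fun x y h => hF.2 (Or.inl h)) ?_
    intro x hx hxa y hxy
    rcases hF.1 hxy with h | h | h
    · exact h
    · exact absurd (h₁₂ x hx (Walk.fst_mem_support_of_mem_edges _ h)).1 hxa
    · exact absurd (h₁ x hx (Walk.fst_mem_support_of_mem_edges _ h)) hxa
  have hD₂ : Demands Y {x | x ∈ c₂.support ∧ x ≠ b} b := by
    refine hY.demands_of_isCycle hc₂ hodd₂ hlen₂ (fun x y h => hF.2 (Or.inr (Or.inl h))) ?_
    intro x hx hxb y hxy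
    rcases hF.1 hxy with h | h | h
    · exact absurd (h₁₂ x (Walk.fst_mem_support_of_mem_edges _ h) hx).2 hxb
    · exact h
    · exact absurd (h₂ x hx (Walk.fst_mem_support_of_mem_edges _ h)) hxb
  have hinj : ∀ {i j}, i ≤ p.length → j ≤ p.length → p.getVert i = p.getVert j → i = j :=
    fun hi hj h => hp.getVert_injOn hi hj h
  have hp₂ : ∀ i ≤ p.length, p.getVert i ∈ c₂.support → i = p.length := fun i hi h =>
    hinj hi le_rfl ((h₂ _ h (p.getVert_mem_support i)).trans p.getVert_length.symm)
  have hpN : ∀ i ≤ p.length, ∀ x, s(p.getVert i, x) ∈ p.edges →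
      (∃ j, j + 1 = i ∧ x = p.getVert j) ∨ (i < p.length ∧ x = p.getVert (i + 1)) := by
    intro i hi x hx
    obtain ⟨j, hj, e⟩ := p.mk_mem_edges_iff_exists.1 hx
    rcases Sym2.eq_iff.1 e with ⟨e1, e2⟩ | ⟨e1, e2⟩
    · obtain rfl := hinj hj.le hi e1
      exact Or.inr ⟨hj, e2.symm⟩
    · exact Or.inl ⟨j, hinj hj hi e2, e1.symm⟩
  set B : ℕ → Set α := fun i => {x | (x ∈ c₁.support ∧ x ≠ a) ∨ ∃ j < i, x = p.getVert j} with hBdef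
  have hnotB : ∀ i j, i ≤ j → j ≤ p.length → p.getVert j ∉ B i := by
    rintro i j hij hj (⟨h, hne⟩ | ⟨l, hl, e⟩)
    · exact hne (h₁ _ h (p.getVert_mem_support j))
    · have := hinj hj (by omega) e
      omega
  have hD : ∀ i ≤ p.length, Demands Y (B i) (p.getVert i) := by
    intro i
    induction i with
    | zero => intro _; simpa [hBdef] using hD₁
    | succ i ih =>
      intro hi
      have hins : B (i + 1) = insert (p.getVert i) (B i) := by
        ext x
        constructor
        · rintro (h | ⟨j, hj, rfl⟩)
          · exact Or.inr (Or.inl h)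
          · rcases Nat.lt_succ_iff_lt_or_eq.1 hj with hj | rfl
            · exact Or.inr (Or.inr ⟨j, hj, rfl⟩)
            · exact Or.inl rfl
        · rintro (rfl | h | ⟨j, hj, rfl⟩)
          · exact Or.inr ⟨i, by omega, rfl⟩
          · exact Or.inl h
          · exact Or.inr ⟨j, by omega, rfl⟩
      rw [hins]
      refine (ih (by omega)).step hY (hnotB i i le_rfl (by omega))
        (hnotB i (i + 1) (by omega) hi)
        (hF.2 (Or.inr (Or.inr (p.mk_mem_edges_iff_exists.2 ⟨i, hi, rfl⟩)))) ?_ ?_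
      · intro y hy x hyx
        have hmem : x ∈ c₁.support → x ∈ B i ∨ x = p.getVert i := by
          intro hx
          by_cases hxa : x = a
          · rcases Nat.eq_zero_or_pos i with rfl | hi0
            · exact Or.inr (by simpa using hxa)
            · exact Or.inl (Or.inr ⟨0, hi0, by simpa using hxa⟩)
          · exact Or.inl (Or.inl ⟨hx, hxa⟩)
        rcases hF.1 hyx with h | h | h
        · exact hmem (Walk.snd_mem_support_of_mem_edges _ h)
        · have hy₂ := Walk.fst_mem_support_of_mem_edges _ h
          rcases hy with ⟨hy, hya⟩ | ⟨j, hj, rfl⟩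
          · exact absurd (h₁₂ y hy hy₂).1 hya
          · have := hp₂ j (by omega) hy₂
            omega
        · rcases hy with ⟨hy, hya⟩ | ⟨j, hj, rfl⟩
          · exact absurd (h₁ y hy (Walk.fst_mem_support_of_mem_edges _ h)) hya
          · rcases hpN j (by omega) x h with ⟨l, hl, rfl⟩ | ⟨-, rfl⟩
            · exact Or.inl (Or.inr ⟨l, by omega, rfl⟩)
            · rcases Nat.eq_or_lt_of_le (show j + 1 ≤ i by omega) with rfl | h'
              · exact Or.inr rfl
              · exact Or.inl (Or.inr ⟨j + 1, h', rfl⟩)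
      · intro x hx
        rcases hF.1 hx with h | h | h
        · have hia := h₁ _ (Walk.fst_mem_support_of_mem_edges _ h) (p.getVert_mem_support i)
          exact Or.inl (Or.inl ⟨Walk.snd_mem_support_of_mem_edges _ h,
            fun e => hx.ne (hia.trans e.symm)⟩)
        · have := hp₂ i (by omega) (Walk.fst_mem_support_of_mem_edges _ h)
          omega
        · rcases hpN i (by omega) x h with ⟨l, hl, rfl⟩ | ⟨-, rfl⟩
          · exact Or.inl (Or.inr ⟨l, by omega, rfl⟩)
          · exact Or.inr rfl
  have hDp := hD p.length le_rfl
  have hbB := hnotB p.length p.length le_rfl le_rfl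
  rw [p.getVert_length] at hDp hbB
  refine not_demands_of_demands hY ?_ hbB (fun h => h.2 rfl) ?_ hDp hD₂
  · refine Set.disjoint_left.2 ?_
    rintro x (⟨hx, hxa⟩ | ⟨j, hj, rfl⟩) ⟨hx', hxb⟩
    · exact hxb (h₁₂ x hx hx').2
    · exact hxb (h₂ _ hx' (p.getVert_mem_support j))
  · intro x hx
    rcases hF.1 hx with h | h | h
    · have hba := (h₁₂ b (Walk.fst_mem_support_of_mem_edges _ h) c₂.start_mem_support).1
      exact Or.inl (Or.inl ⟨Walk.snd_mem_support_of_mem_edges _ h,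
        fun e => hx.ne (hba.trans e.symm)⟩)
    · exact Or.inr ⟨Walk.snd_mem_support_of_mem_edges _ h, hx.ne'⟩
    · rcases hpN p.length le_rfl x (p.getVert_length.symm ▸ h) with ⟨l, hl, rfl⟩ | ⟨h, -⟩
      · exact Or.inl (Or.inr ⟨l, by omega, rfl⟩)
      · omega

theorem SimpleGraph.Connected.exists_linking_path {α : Type} {H : SimpleGraph α}
    (hconn : H.Connected) {S T : Set α} (hS : S.Nonempty) (hT : T.Nonempty)
    (hST : (S ∩ T).Subsingleton) :
    ∃ a ∈ S, ∃ b ∈ T, ∃ p : H.Walk a b, p.IsPath ∧ (∀ x ∈ S, x ∈ p.support → x = a) ∧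
      (∀ x ∈ T, x ∈ p.support → x = b) ∧ ∀ x ∈ S, x ∈ T → x = a ∧ x = b := by
  classical
  have hex : ∃ n, ∃ a ∈ S, ∃ b ∈ T, ∃ p : H.Walk a b, p.length = n := by
    obtain ⟨s, hs⟩ := hS
    obtain ⟨t, ht⟩ := hT
    obtain ⟨p⟩ := hconn.preconnected s t
    exact ⟨_, s, hs, t, ht, p, rfl⟩
  obtain ⟨a, ha, b, hb, q, hq⟩ := Nat.find_spec hex
  have hmin : ∀ {a'}, a' ∈ S → ∀ {b'}, b' ∈ T → ∀ r : H.Walk a' b', q.length ≤ r.length :=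
    fun ha' _ hb' r => hq ▸ Nat.find_min' hex ⟨_, ha', _, hb', r, rfl⟩
  have hlen : q.bypass.length = q.length :=
    le_antisymm q.length_bypass_le_length (hmin ha hb _)
  refine ⟨a, ha, b, hb, q.bypass, q.bypass_isPath, ?_, ?_, ?_⟩
  · intro x hx hxp
    have h1 := hmin hx hb (q.bypass.dropUntil x hxp)
    have h2 := congrArg Walk.length (q.bypass.take_spec hxp)
    rw [Walk.length_append] at h2
    exact (Walk.eq_of_length_eq_zero (p := q.bypass.takeUntil x hxp) (by omega)).symm
  · intro x hx hxp
    by_contra hne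
    have h1 := hmin ha hx (q.bypass.takeUntil x hxp)
    have h2 := Walk.length_takeUntil_lt_length hxp hne
    omega
  · intro x hx hx'
    have h0 := hmin hx hx' (Walk.nil : H.Walk x x)
    obtain rfl := Walk.eq_of_length_eq_zero (p := q) (by simpa using h0)
    exact ⟨hST ⟨hx, hx'⟩ ⟨ha, hb⟩, hST ⟨hx, hx'⟩ ⟨ha, hb⟩⟩

/-- A connected graph containing two odd cycles, each of length at
least 5, sharing at most one vertex, is not rooted-contractible. -/
theorem two_long_odd_cycles_not_contractible {α : Type} [Fintype α]
    (H : SimpleGraph α) (hconn : H.Connected)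
    (u v : α) (c₁ : H.Walk u u) (c₂ : H.Walk v v)
    (hc₁ : c₁.IsCycle) (hc₂ : c₂.IsCycle)
    (hodd₁ : Odd c₁.length) (hodd₂ : Odd c₂.length)
    (hlen₁ : 5 ≤ c₁.length) (hlen₂ : 5 ≤ c₂.length)
    (hshare : Set.Subsingleton {x | x ∈ c₁.support ∧ x ∈ c₂.support}) :
    ¬ IsRootedContractible H := by
  classical
  obtain ⟨a, ha, b, hb, p, hp, h₁, h₂, h₁₂⟩ := hconn.exists_linking_path
    (S := {x | x ∈ c₁.support}) (T := {x | x ∈ c₂.support})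
    ⟨u, c₁.start_mem_support⟩ ⟨v, c₂.start_mem_support⟩ hshare
  refine not_isRootedContractible_of_linked_cycles (c₁ := c₁.rotate a ha) (c₂ := c₂.rotate b hb)
    ((Walk.isCycle_rotate ha).2 hc₁) ((Walk.isCycle_rotate hb).2 hc₂) hp
    (by rwa [Walk.length_rotate]) (by rwa [Walk.length_rotate])
    (by rwa [Walk.length_rotate]) (by rwa [Walk.length_rotate]) ?_ ?_ ?_
  · exact fun x hx => h₁ x ((Walk.mem_support_rotate_iff _ _ ha).1 hx)
  · exact fun x hx => h₂ x ((Walk.mem_support_rotate_iff _ _ hb).1 hx)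
  · exact fun x hx hx' => h₁₂ x ((Walk.mem_support_rotate_iff _ _ ha).1 hx)
      ((Walk.mem_support_rotate_iff _ _ hb).1 hx')
end

section
/- Every cactus in which at most one cycle has more than 3 vertices is rooted-contractible. -/
open SimpleGraph

/-- A cactus: a connected graph in which every block is an edge or a cycle;
equivalently, a connected graph in which any two distinct cycles share at most
one vertex. -/
def IsCactus {α : Type} (H : SimpleGraph α) : Prop :=
  H.Connected ∧
    ∀ (u v : α) (c₁ : H.Walk u u) (c₂ : H.Walk v v),
      c₁.IsCycle → c₂.IsCycle → {e | e ∈ c₁.edges} ≠ {e | e ∈ c₂.edges} →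
      Set.Subsingleton {x | x ∈ c₁.support ∧ x ∈ c₂.support}

/-- Connectedness of `G[T]`, expressed through edge cuts. -/
def CutConnected {β : Type} (G : SimpleGraph β) (T : Set β) : Prop :=
  T.Nonempty ∧ ∀ A : Set β, (∃ x ∈ T, x ∈ A) → (∃ y ∈ T, y ∉ A) →
    ∃ x ∈ T, x ∈ A ∧ ∃ y ∈ T, y ∉ A ∧ G.Adj x y

namespace CutConnected

variable {β : Type} {G : SimpleGraph β} {A B S T : Set β}

lemma iff_induce_connected : CutConnected G T ↔ (G.induce T).Connected := by
  constructor
  · rintro ⟨⟨a, ha⟩, hcut⟩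
    have : Nonempty T := ⟨⟨a, ha⟩⟩
    refine ⟨fun x y => ?_⟩
    by_contra hxy
    obtain ⟨p, hp, ⟨hpT, hxp⟩, q, hq, hxq, hpq⟩ :=
      hcut {z | ∃ h : z ∈ T, (G.induce T).Reachable x ⟨z, h⟩}
        ⟨x, x.2, x.2, Reachable.refl _⟩ ⟨y, y.2, fun ⟨_, h⟩ => hxy h⟩
    exact hxq ⟨hq, hxp.trans (Adj.reachable (by simpa using hpq))⟩
  · intro h
    obtain ⟨a⟩ := h.nonempty
    refine ⟨⟨a, a.2⟩, ?_⟩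
    rintro A ⟨x, hx, hxA⟩ ⟨y, hy, hyA⟩
    obtain ⟨p⟩ := h.preconnected ⟨x, hx⟩ ⟨y, hy⟩
    obtain ⟨d, -, h1, h2⟩ := p.exists_boundary_dart {z | (z : β) ∈ A} hxA hyA
    exact ⟨d.fst, d.fst.2, h1, d.snd, d.snd.2, h2, d.adj⟩

lemma singleton (G : SimpleGraph β) (x : β) : CutConnected G {x} := by
  refine ⟨⟨x, rfl⟩, ?_⟩
  rintro A ⟨_, rfl, h1⟩ ⟨_, rfl, h2⟩
  exact absurd h1 h2

lemma union (hA : CutConnected G A) (hB : CutConnected G B)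
    (h : ∃ a ∈ A, ∃ b ∈ B, a = b ∨ G.Adj a b) : CutConnected G (A ∪ B) := by
  obtain ⟨a, ha, b, hb, hab⟩ := h
  refine ⟨⟨a, Or.inl ha⟩, fun X hX hX' => ?_⟩
  by_cases h1 : (∃ x ∈ A, x ∈ X) ∧ ∃ y ∈ A, y ∉ X
  · obtain ⟨x, hx, hxX, y, hy, hyX, hxy⟩ := hA.2 X h1.1 h1.2
    exact ⟨x, Or.inl hx, hxX, y, Or.inl hy, hyX, hxy⟩
  by_cases h2 : (∃ x ∈ B, x ∈ X) ∧ ∃ y ∈ B, y ∉ X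
  · obtain ⟨x, hx, hxX, y, hy, hyX, hxy⟩ := hB.2 X h2.1 h2.2
    exact ⟨x, Or.inr hx, hxX, y, Or.inr hy, hyX, hxy⟩
  have hne : a ∈ X ↔ b ∉ X := by
    obtain ⟨x, hx, hxX⟩ := hX
    obtain ⟨y, hy, hyX⟩ := hX'
    simp only [Set.mem_union] at hx hy
    grind
  have hadj : G.Adj a b := hab.resolve_left (by rintro rfl; tauto)
  by_cases haX : a ∈ X
  · exact ⟨a, Or.inl ha, haX, b, Or.inr hb, hne.1 haX, hadj⟩
  · exact ⟨b, Or.inr hb, by tauto, a, Or.inl ha, haX, hadj.symm⟩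

lemma insert (hA : CutConnected G A) {x : β} (h : ∃ a ∈ A, G.Adj a x) :
    CutConnected G (insert x A) := by
  obtain ⟨a, ha, hax⟩ := h
  rw [Set.insert_eq, Set.union_comm]
  exact hA.union (singleton G x) ⟨a, ha, x, rfl, Or.inr hax⟩

lemma exists_component [Finite β] (hA : CutConnected G A) (hAT : A ⊆ T) :
    ∃ K, A ⊆ K ∧ K ⊆ T ∧ CutConnected G K ∧ ∀ y ∈ T, (∃ k ∈ K, G.Adj k y) → y ∈ K := by
  obtain ⟨K, hK⟩ := (Set.toFinite {K : Set β | A ⊆ K ∧ K ⊆ T ∧ CutConnected G K}).exists_maximal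
    ⟨A, subset_rfl, hAT, hA⟩
  obtain ⟨hAK, hKT, hKc⟩ := hK.prop
  refine ⟨K, hAK, hKT, hKc, fun y hy hk => ?_⟩
  exact hK.le_of_ge ⟨hAK.trans (Set.subset_insert y K), Set.insert_subset hy hKT, hKc.insert hk⟩
    (Set.subset_insert y K) (Set.mem_insert y K)

end CutConnected

/-- `S` is an inclusion-minimal set joining the disjoint, non-adjacent connected sets `A` and `B`. -/
structure IsMinimalLink {β : Type} (G : SimpleGraph β) (A S B : Set β) : Prop where
  left : CutConnected G A
  right : CutConnected G B
  disjoint : Disjoint A B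
  disjoint_left : Disjoint S A
  disjoint_right : Disjoint S B
  connected : CutConnected G (A ∪ S ∪ B)
  minimal : ∀ S' ⊆ S, CutConnected G (A ∪ S' ∪ B) → S' = S
  not_adj : ∀ a ∈ A, ∀ b ∈ B, ¬ G.Adj a b

namespace IsMinimalLink

variable {β : Type} {G : SimpleGraph β} {A S B : Set β}

lemma symm (h : IsMinimalLink G A S B) : IsMinimalLink G B S A where
  left := h.right
  right := h.left
  disjoint := h.disjoint.symm
  disjoint_left := h.disjoint_right
  disjoint_right := h.disjoint_left
  connected := by
    have := h.connected
    rwa [show A ∪ S ∪ B = B ∪ S ∪ A by grind] at this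
  minimal S' hS' hc := h.minimal S' hS' (by
    rwa [show A ∪ S' ∪ B = B ∪ S' ∪ A by grind])
  not_adj b hb a ha hab := h.not_adj a ha b hb hab.symm

lemma exists_adj_left (h : IsMinimalLink G A S B) : ∃ x ∈ S, ∃ a ∈ A, G.Adj a x := by
  obtain ⟨a, ha⟩ := h.left.1
  obtain ⟨b, hb⟩ := h.right.1
  obtain ⟨x, -, hxA, y, hy, hyA, hxy⟩ := h.connected.2 A ⟨a, by grind, ha⟩
    ⟨b, by grind, fun hbA => h.disjoint.le_bot ⟨hbA, hb⟩⟩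
  have : y ∉ B := fun hyB => h.not_adj x hxA y hyB hxy
  exact ⟨y, by grind, x, hxA, hxy⟩

lemma eq_of_connected (h : IsMinimalLink G A S B) {T : Set β} (hA : A ⊆ T) (hB : B ⊆ T)
    (hT : T ⊆ A ∪ S ∪ B) (hTc : CutConnected G T) : S ⊆ T := by
  have := h.minimal (S ∩ T) Set.inter_subset_left
    (by rwa [show A ∪ S ∩ T ∪ B = T by ext; grind])
  grind

lemma connected_union_left [Finite β] (h : IsMinimalLink G A S B) : CutConnected G (A ∪ S) := by
  obtain ⟨K, hAK, hK, hKc, hmax⟩ := h.left.exists_component (T := A ∪ S) Set.subset_union_left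
  obtain ⟨a, ha⟩ := h.left.1
  obtain ⟨b, hb⟩ := h.right.1
  have hdA := h.disjoint.notMem_of_mem_right hb
  have hdS := h.disjoint_right.notMem_of_mem_right hb
  obtain ⟨x, -, hxK, y, hy, hyK, hxy⟩ := h.connected.2 K ⟨a, by grind, hAK ha⟩ ⟨b, by grind, by grind⟩
  have hyB : y ∈ B := by
    by_contra hyB
    exact hyK (hmax y (by grind) ⟨x, hxK, hxy⟩)
  have hsub := h.eq_of_connected (T := K ∪ B) (by grind) (by grind) (by grind)
    (hKc.union h.right ⟨x, hxK, y, hyB, Or.inr hxy⟩)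
  have hdis := h.disjoint_right
  rw [show A ∪ S = K from ?_]
  · exact hKc
  · rw [Set.disjoint_left] at hdis
    apply subset_antisymm _ hK
    intro z hz
    grind

/-- A minimal link can be cut between any two of its vertices. -/
lemma exists_split [Finite β] (h : IsMinimalLink G A S B) {x x' : β} (hx : x ∈ S) (hx' : x' ∈ S)
    (hne : x ≠ x') :
    ∃ D E, A ⊆ D ∧ B ⊆ E ∧ D ⊆ A ∪ S ∪ B ∧ E ⊆ A ∪ S ∪ B ∧ Disjoint D E ∧
      CutConnected G D ∧ CutConnected G E ∧ (∃ d ∈ D, ∃ e ∈ E, G.Adj d e) ∧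
      (x ∈ D ∧ x' ∈ E ∨ x' ∈ D ∧ x ∈ E) := by
  have hxA := h.disjoint_left.notMem_of_mem_left hx
  have hxB := h.disjoint_right.notMem_of_mem_left hx
  obtain ⟨K, hAK, hK, hKc, hmax⟩ := h.left.exists_component (T := (A ∪ S ∪ B) \ {x})
    (by intro a ha; simp only [Set.mem_sdiff, Set.mem_singleton_iff]; grind)
  obtain ⟨L, hBL, hL, hLc, hLmax⟩ := h.right.exists_component (T := (A ∪ S ∪ B) \ {x})
    (by intro a ha; simp only [Set.mem_sdiff, Set.mem_singleton_iff]; grind)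
  obtain ⟨a, ha⟩ := h.left.1
  obtain ⟨b, hb⟩ := h.right.1
  have hxK : x ∉ K := fun hh => (hK hh).2 rfl
  have hxL : x ∉ L := fun hh => (hL hh).2 rfl
  have hdisj : Disjoint K L := by
    rw [Set.disjoint_left]
    intro z hzK hzL
    have := h.eq_of_connected (T := K ∪ L) (by grind) (by grind) (by grind)
      (hKc.union hLc ⟨z, hzK, z, hzL, Or.inl rfl⟩) hx
    grind
  rw [Set.disjoint_left] at hdisj
  obtain ⟨p, -, hpK, q, hq, hqK, hpq⟩ := h.connected.2 K ⟨a, by grind, hAK ha⟩ ⟨b, by grind, by grind⟩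
  obtain rfl : q = x := by
    by_contra hne'
    exact hqK (hmax q ⟨hq, hne'⟩ ⟨p, hpK, hpq⟩)
  obtain ⟨r, -, hrL, s, hs, hsL, hrs⟩ := h.connected.2 L ⟨b, by grind, hBL hb⟩ ⟨a, by grind, by grind⟩
  obtain rfl : s = q := by
    by_contra hne'
    exact hsL (hLmax s ⟨hs, hne'⟩ ⟨r, hrL, hrs⟩)
  have hKs := hKc.insert ⟨p, hpK, hpq⟩
  have hLs := hLc.insert ⟨r, hrL, hrs⟩
  have hall := h.eq_of_connected (T := insert s K ∪ L) (by grind) (by grind) (by grind)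
      (hKs.union hLc ⟨s, by grind, r, hrL, Or.inr hrs.symm⟩) hx'
  rcases hall with (hh | hh) | hh
  · exact absurd hh.symm hne
  · refine ⟨K, insert s L, hAK, by grind, by grind, by grind, ?_, hKc, hLs,
      ⟨p, hpK, s, by grind, hpq⟩, Or.inr ⟨hh, by grind⟩⟩
    rw [Set.disjoint_left]; grind
  · refine ⟨insert s K, L, by grind, hBL, by grind, by grind, ?_, hKs, hLc,
      ⟨s, by grind, r, hrL, hrs.symm⟩, Or.inl ⟨by grind, hh⟩⟩
    rw [Set.disjoint_left]; grind

end IsMinimalLink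

/-- Distinct cycles of `H` share at most one vertex, and at most one cycle is longer than `3`. -/
def ThinCycles {α : Type} (H : SimpleGraph α) : Prop :=
  (∀ (u v : α) (c₁ : H.Walk u u) (c₂ : H.Walk v v),
      c₁.IsCycle → c₂.IsCycle → {e | e ∈ c₁.edges} ≠ {e | e ∈ c₂.edges} →
      Set.Subsingleton {x | x ∈ c₁.support ∧ x ∈ c₂.support}) ∧
  ∀ (u v : α) (c₁ : H.Walk u u) (c₂ : H.Walk v v),
      c₁.IsCycle → c₂.IsCycle → 3 < c₁.length → 3 < c₂.length →
      {e | e ∈ c₁.edges} = {e | e ∈ c₂.edges}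

lemma ThinCycles.mono {α : Type} {H H' : SimpleGraph α} (h : ThinCycles H) (hle : H' ≤ H) :
    ThinCycles H' := by
  constructor
  · intro u v c₁ c₂ h₁ h₂
    simpa using h.1 u v (c₁.mapLe hle) (c₂.mapLe hle) (h₁.mapLe hle) (h₂.mapLe hle)
  · intro u v c₁ c₂ h₁ h₂
    simpa using h.2 u v (c₁.mapLe hle) (c₂.mapLe hle) (h₁.mapLe hle) (h₂.mapLe hle)

/-- A path of maximum length in `H`. -/
def IsLongestPath {α : Type} {H : SimpleGraph α} {a b : α} (p : H.Walk a b) : Prop :=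
  p.IsPath ∧ ∀ (u v : α) (q : H.Walk u v), q.IsPath → q.length ≤ p.length

namespace IsLongestPath

open Classical in
lemma isCycle_cons_takeUntil {α : Type} {H : SimpleGraph α} {a b c : α} {p : H.Walk a b}
    (hp : p.IsPath) (hc : c ∈ p.support) (h : H.Adj c a) (hs : c ≠ p.snd) :
    (Walk.cons h (p.takeUntil c hc)).IsCycle := by
  rw [Walk.cons_isCycle_iff]
  refine ⟨hp.takeUntil hc, fun he => hs (hp.eq_snd_of_mem_edges ?_)⟩
  rw [Sym2.eq_swap]
  exact p.edges_takeUntil_subset_edges hc he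

variable {α : Type} {H : SimpleGraph α} {a b : α} {p : H.Walk a b}

lemma of_length_eq (hp : IsLongestPath p) {a' b' : α} {q : H.Walk a' b'} (hq : q.IsPath)
    (hlen : q.length = p.length) : IsLongestPath q :=
  ⟨hq, fun u v r hr => hlen ▸ hp.2 u v r hr⟩

lemma reverse (hp : IsLongestPath p) : IsLongestPath p.reverse :=
  hp.of_length_eq hp.1.reverse (by simp)

lemma mem_support (hp : IsLongestPath p) {c : α} (h : H.Adj c a) : c ∈ p.support := by
  by_contra hc
  have := hp.2 _ _ (Walk.cons h p) (hp.1.cons hc)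
  simp at this

lemma eq_of_adj_of_ne_snd (hp : IsLongestPath p) (hH : ThinCycles H) {c d : α}
    (hc : H.Adj c a) (hd : H.Adj d a) (hcs : c ≠ p.snd) (hds : d ≠ p.snd) : c = d := by
  classical
  have hcm := hp.mem_support hc
  have hdm := hp.mem_support hd
  have h1 := isCycle_cons_takeUntil hp.1 hcm hc hcs
  have h2 := isCycle_cons_takeUntil hp.1 hdm hd hds
  by_contra hne
  have hsnd : ∀ {e : α} (he : e ∈ p.support), e ≠ a → p.snd ∈ (p.takeUntil e he).support := by
    intro e he hea
    rw [← p.snd_takeUntil hea he]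
    exact Walk.getVert_mem_support _ _
  have hsub := hH.1 _ _ _ _ h1 h2 (fun heq => by
    have : s(d, a) ∈ (Walk.cons hc (p.takeUntil c hcm)).edges := by
      rw [Set.ext_iff] at heq
      exact (heq s(d, a)).2 (by simp)
    rw [Walk.edges_cons, List.mem_cons] at this
    rcases this with h | h
    · have := hc.ne
      have := hd.ne
      rw [Sym2.eq_iff] at h
      grind
    · rw [Sym2.eq_swap] at h
      exact hds (hp.1.eq_snd_of_mem_edges (p.edges_takeUntil_subset_edges hcm h)))
  have hnil : ¬ p.Nil := by
    intro hn
    have := Walk.nil_iff_support_eq.1 hn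
    rw [this] at hcm
    exact hc.ne (by simpa using hcm)
  refine (p.adj_snd hnil).ne (hsub ⟨?_, ?_⟩ ⟨?_, ?_⟩)
  · simp
  · simp
  · simp [hsnd hcm hc.ne]
  · simp [hsnd hdm hd.ne]

lemma eq_or_eq_of_adj (hp : IsLongestPath p) (hH : ThinCycles H) {c d e : α}
    (hc : H.Adj a c) (hd : H.Adj a d) (he : H.Adj a e) (hcd : c ≠ d) : e = c ∨ e = d := by
  have := hp.eq_of_adj_of_ne_snd hH hc.symm hd.symm
  have := hp.eq_of_adj_of_ne_snd hH hc.symm he.symm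
  have := hp.eq_of_adj_of_ne_snd hH hd.symm he.symm
  by_cases hc' : c = p.snd <;> by_cases he' : e = p.snd <;> grind

end IsLongestPath

/-- A triangle of `H` with two vertices of degree two. -/
def IsPendantTriangle {α : Type} (H : SimpleGraph α) (u v w : α) : Prop :=
  H.Adj u v ∧ H.Adj u w ∧ H.Adj v w ∧ (∀ x, H.Adj v x → x = u ∨ x = w) ∧
    ∀ x, H.Adj w x → x = u ∨ x = v

/-- `σ` rotates a cycle that is a component of `H` and fixes all other vertices. -/
def IsCycleRotation {α : Type} (H : SimpleGraph α) (σ : Equiv.Perm α) : Prop :=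
  ∀ u, σ u ≠ u → H.Adj u (σ u) ∧ σ (σ u) ≠ u ∧ ∀ v, H.Adj u v → v = σ u ∨ u = σ v

namespace IsLongestPath

variable {α : Type} {H : SimpleGraph α} {a b : α} {p : H.Walk a b}

open Classical in
lemma pendantTriangle_or_long_cycle (hp : IsLongestPath p) (hH : ThinCycles H)
    (hdeg : ∀ u v, H.Adj u v → ∃ t, t ≠ u ∧ H.Adj v t) (hne : ∃ u v, H.Adj u v) :
    (∃ u v w, IsPendantTriangle H u v w) ∨
      ∃ c, ∃ hc : c ∈ p.support, H.Adj c a ∧ c ≠ p.snd ∧ 3 ≤ (p.takeUntil c hc).length := by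
  have hpos : 1 ≤ p.length := by
    obtain ⟨u, v, huv⟩ := hne
    simpa using hp.2 _ _ (Walk.cons huv Walk.nil) (by simp [huv.ne])
  have hnil : ¬ p.Nil := by rw [Walk.not_nil_iff_lt_length]; omega
  obtain ⟨c, hcs, hac⟩ := hdeg _ _ (p.adj_snd hnil).symm
  have hcm := hp.mem_support hac.symm
  cases p with
  | nil => simp at hpos
  | @cons _ s _ h1 q =>
    rw [Walk.snd_cons] at hcs
    cases q with
    | nil => exact absurd hcm (by simp [hac.ne', hcs])
    | @cons _ m _ h2 r =>
      by_cases hcm' : c = m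
      · subst hcm'
        have hpath := hp.1
        simp only [Walk.cons_isPath_iff, Walk.support_cons, List.mem_cons, not_or] at hpath
        have hp' : IsLongestPath (Walk.cons h1.symm (Walk.cons hac r)) := by
          apply hp.of_length_eq
          · simp only [Walk.cons_isPath_iff, Walk.support_cons, List.mem_cons, not_or]
            grind
          · simp
        refine Or.inl ⟨c, a, s, hac.symm, h2.symm, h1, ?_, ?_⟩
        · intro x hx
          exact hp.eq_or_eq_of_adj hH hac h1 hx hcs
        · intro x hx
          exact hp'.eq_or_eq_of_adj hH h2 h1.symm hx hac.ne'
      · refine Or.inr ⟨c, hcm, hac.symm, by simpa using hcs, ?_⟩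
        by_contra! hlt
        have hg := Walk.getVert_length_takeUntil hcm
        have := hac.ne
        generalize (Walk.takeUntil _ c hcm).length = n at hlt hg
        interval_cases n
        · simp at hg; grind
        · simp at hg; grind
        · simp at hg; grind

lemma isCycleRotation [DecidableEq α] (hp : IsLongestPath p) (hH : ThinCycles H)
    (hba : H.Adj b a) (hlen : 2 ≤ p.length) : IsCycleRotation H p.support.formPerm := by
  have hnd := hp.1.support_nodup
  have hsl := p.length_support
  have hcyc : (Walk.cons hba p).IsCycle := by
    rw [Walk.cons_isCycle_iff]
    refine ⟨hp.1, fun h => ?_⟩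
    have := hp.1.eq_snd_of_mem_edges (by rwa [Sym2.eq_swap])
    have h2 : p.getVert p.length = p.getVert 1 := by simpa using this
    have := hp.1.getVert_injOn (by simp) (by simp; omega) h2
    omega
  have hdeg : ∀ v ∈ p.support, ∀ c d e, H.Adj v c → H.Adj v d → H.Adj v e → c ≠ d →
      e = c ∨ e = d := by
    intro v hv c d e hc hd he hcd
    have hv' : v ∈ (Walk.cons hba p).support := by simp [hv]
    have hr := hcyc.rotate hv'
    have hlong : IsLongestPath ((Walk.cons hba p).rotate v hv').tail := by
      apply hp.of_length_eq hr.isPath_tail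
      simp
    exact hlong.reverse.eq_or_eq_of_adj hH hc hd he hcd
  have hstep : ∀ i (hi : i < p.support.length),
      p.support.formPerm p.support[i] = p.support[(i + 1) % p.support.length]'(Nat.mod_lt _ (by omega)) :=
    fun i hi => List.formPerm_apply_getElem _ hnd i hi
  have hadj : ∀ v ∈ p.support, H.Adj v (p.support.formPerm v) := by
    intro v hv
    obtain ⟨i, hi, rfl⟩ := List.getElem_of_mem hv
    rw [hstep]
    simp only [Walk.support_getElem_eq_getVert]
    by_cases h : i = p.length
    · subst h
      simp [hsl, hba]
    · rw [Nat.mod_eq_of_lt (by omega)]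
      exact p.adj_getVert_succ (by omega)
  have htwo : ∀ v ∈ p.support, p.support.formPerm (p.support.formPerm v) ≠ v := by
    intro v hv
    obtain ⟨i, hi, rfl⟩ := List.getElem_of_mem hv
    rw [hstep, hstep, Ne, hnd.getElem_inj_iff, Nat.mod_add_mod]
    intro h
    by_cases h2 : i + 1 + 1 < p.support.length
    · rw [Nat.mod_eq_of_lt h2] at h
      omega
    · rw [Nat.mod_eq_sub_mod (by omega), Nat.mod_eq_of_lt (by omega)] at h
      omega
  intro u hu
  have hum : u ∈ p.support := by
    by_contra h
    exact hu (List.formPerm_apply_of_notMem h)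
  refine ⟨hadj u hum, htwo u hum, fun v hv => ?_⟩
  set σ := p.support.formPerm with hσ
  have hpre : σ⁻¹ u ∈ p.support := by
    rw [← List.formPerm_mem_iff_mem, ← hσ]
    simpa using hum
  have h1 : H.Adj u (σ⁻¹ u) := by simpa using (hadj _ hpre).symm
  have h2 : σ u ≠ σ⁻¹ u := by
    intro h
    apply htwo u hum
    rw [h]
    simp
  rcases hdeg u hum _ _ v (hadj u hum) h1 hv h2 with h | h
  · exact Or.inl h
  · exact Or.inr (by simp [h])

end IsLongestPath

lemma exists_pendantTriangle_or_cycleRotation {α : Type} [Finite α] {H : SimpleGraph α}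
    (hH : ThinCycles H) (hdeg : ∀ u v, H.Adj u v → ∃ t, t ≠ u ∧ H.Adj v t)
    (hne : ∃ u v, H.Adj u v) :
    (∃ u v w, IsPendantTriangle H u v w) ∨
      ∃ σ : Equiv.Perm α, IsCycleRotation H σ ∧ ∃ z, σ z ≠ z := by
  classical
  have : Nonempty α := ⟨hne.choose⟩
  obtain ⟨a, b, p, hp, hmax⟩ := Walk.exists_isPath_forall_isPath_length_le_length H
  have hp : IsLongestPath p := ⟨hp, hmax⟩
  rcases hp.pendantTriangle_or_long_cycle hH hdeg hne with h | ⟨c, hc, hca, hcs, hcl⟩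
  · exact Or.inl h
  rcases hp.reverse.pendantTriangle_or_long_cycle hH hdeg hne with h | ⟨d, hd, hdb, hds, hdl⟩
  · exact Or.inl h
  right
  have heq := hH.2 _ _ _ _ (IsLongestPath.isCycle_cons_takeUntil hp.1 hc hca hcs)
    (IsLongestPath.isCycle_cons_takeUntil hp.reverse.1 hd hdb hds) (by simp; omega) (by simp; omega)
  have hb : b ∈ (Walk.cons hca (p.takeUntil c hc)).support := by
    rw [Set.ext_iff] at heq
    have : s(d, b) ∈ (Walk.cons hca (p.takeUntil c hc)).edges := (heq s(d, b)).2 (by simp)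
    exact Walk.snd_mem_support_of_mem_edges _ this
  have hb' : b ∈ (p.takeUntil c hc).support := by
    rw [Walk.support_cons, List.mem_cons] at hb
    rcases hb with rfl | hb
    · exact Walk.end_mem_support _
    · exact hb
  obtain rfl : c = b := by
    by_contra hne'
    exact Walk.endpoint_notMem_support_takeUntil hp.1 hc (Ne.symm hne') hb'
  have hlen := p.length_takeUntil_le_length hc
  refine ⟨p.support.formPerm, hp.isCycleRotation hH hca (by omega), c, ?_⟩
  rw [List.formPerm_apply_mem_ne_self_iff _ hp.1.support_nodup _ hc, Walk.length_support]
  omega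

/-- Disjoint connected root sets `R v` together with, for each edge `uv` of `H`, a set `S u v`
avoiding all root sets and joining `R u` to `R v`, such that the edges whose sets contain a given
vertex have a common endpoint. -/
structure LinkScheme {α β : Type} (H : SimpleGraph α) (G : SimpleGraph β) (R : α → Set β)
    (S : α → α → Set β) : Prop where
  symm : ∀ u v, S u v = S v u
  root_connected : ∀ v, CutConnected G (R v)
  root_disjoint : Pairwise fun u v => Disjoint (R u) (R v)
  notMem_root : ∀ u v, H.Adj u v → ∀ x ∈ S u v, ∀ w, x ∉ R w
  connected : ∀ u v, H.Adj u v → CutConnected G (R u ∪ S u v ∪ R v)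
  center : ∀ x, ∃ z, ∀ u v, H.Adj u v → x ∈ S u v → z = u ∨ z = v

/-- `H` is a minor of `G` with branch sets extending the sets `R v`. -/
def ExtendsToMinor {α β : Type} (H : SimpleGraph α) (G : SimpleGraph β) (R : α → Set β) : Prop :=
  ∃ C : α → Set β, (∀ v, R v ⊆ C v) ∧ (∀ v, CutConnected G (C v)) ∧
    (Pairwise fun u v => Disjoint (C u) (C v)) ∧
    ∀ u v, H.Adj u v → ∃ x ∈ C u, ∃ y ∈ C v, G.Adj x y

lemma ExtendsToMinor.mono {α β : Type} {H : SimpleGraph α} {G : SimpleGraph β} {R R' : α → Set β}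
    (h : ExtendsToMinor H G R') (hR : ∀ v, R v ⊆ R' v) : ExtendsToMinor H G R := by
  obtain ⟨C, h1, h2⟩ := h
  exact ⟨C, fun v => (hR v).trans (h1 v), h2⟩

/-- Edges between already adjacent root sets come for free. -/
lemma ExtendsToMinor.of_le {α β : Type} {H H' : SimpleGraph α} {G : SimpleGraph β} {R : α → Set β}
    (h : ExtendsToMinor H' G R)
    (hH : ∀ u v, H.Adj u v → H'.Adj u v ∨ ∃ x ∈ R u, ∃ y ∈ R v, G.Adj x y) :
    ExtendsToMinor H G R := by
  obtain ⟨C, h1, h2, h3, h4⟩ := h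
  refine ⟨C, h1, h2, h3, fun u v huv => ?_⟩
  rcases hH u v huv with h | ⟨x, hx, y, hy, hxy⟩
  · exact h4 u v h
  · exact ⟨x, h1 u hx, y, h1 v hy, hxy⟩

/-- The total size of the links plus twice the number of edges. -/
noncomputable def linkWeight {α β : Type} (H : SimpleGraph α) (S : α → α → Set β) : ℕ :=
  {q : (α × α) × β | q.2 ∈ S q.1.1 q.1.2}.ncard + {q : α × α | H.Adj q.1 q.2}.ncard

namespace LinkScheme

variable {α β : Type} {H : SimpleGraph α} {G : SimpleGraph β}
  {R : α → Set β} {S : α → α → Set β}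

lemma weight_lt_of_edges [Finite α] {H' : SimpleGraph α} (hle : H' ≤ H) {u v : α} (huv : H.Adj u v)
    (huv' : ¬ H'.Adj u v) : linkWeight H' S < linkWeight H S := by
  apply Nat.add_lt_add_left
  apply Set.ncard_lt_ncard _ (Set.toFinite _)
  exact (Set.ssubset_iff_of_subset fun q hq => hle hq).2 ⟨(u, v), huv, huv'⟩

lemma weight_lt_of_links [Finite α] [Finite β] {S' : α → α → Set β} (hle : ∀ u v, S' u v ⊆ S u v) {u v : α} {x : β}
    (hx : x ∈ S u v) (hx' : x ∉ S' u v) : linkWeight H S' < linkWeight H S := by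
  apply Nat.add_lt_add_right
  apply Set.ncard_lt_ncard _ (Set.toFinite _)
  exact (Set.ssubset_iff_of_subset fun q hq => hle q.1.1 q.1.2 hq).2 ⟨((u, v), x), hx, hx'⟩

lemma weight_perm (σ : Equiv.Perm α) :
    linkWeight H (fun u v => S (σ u) (σ v)) = linkWeight H S := by
  unfold linkWeight
  congr 1
  have := Set.ncard_image_of_injective {q : (α × α) × β | q.2 ∈ S (σ q.1.1) (σ q.1.2)}
    (Equiv.prodCongr (Equiv.prodCongr σ σ) (Equiv.refl β)).injective
  rw [← this]
  congr 1
  rw [Equiv.image_eq_preimage_symm]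
  ext ⟨⟨u, v⟩, x⟩
  simp

lemma mono (h : LinkScheme H G R S) {H' : SimpleGraph α} (hle : H' ≤ H) : LinkScheme H' G R S where
  symm := h.symm
  root_connected := h.root_connected
  root_disjoint := h.root_disjoint
  notMem_root u v huv := h.notMem_root u v (hle huv)
  connected u v huv := h.connected u v (hle huv)
  center x := by
    obtain ⟨z, hz⟩ := h.center x
    exact ⟨z, fun u v huv => hz u v (hle huv)⟩

open Classical in
/-- Replace the link of the edge `uv` by a smaller one. -/
lemma shrink (h : LinkScheme H G R S) {u v : α} (huv : H.Adj u v) {T : Set β} (hT : T ⊆ S u v)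
    (hc : CutConnected G (R u ∪ T ∪ R v)) :
    LinkScheme H G R (fun a b => if s(a, b) = s(u, v) then T else S a b) where
  symm a b := by
    have := h.symm a b
    grind [Sym2.eq_swap]
  root_connected := h.root_connected
  root_disjoint := h.root_disjoint
  notMem_root a b hab x hx := by
    split_ifs at hx with hs
    · exact h.notMem_root u v huv x (hT hx)
    · exact h.notMem_root a b hab x hx
  connected a b hab := by
    split_ifs with hs
    · rcases Sym2.eq_iff.1 hs with ⟨rfl, rfl⟩ | ⟨rfl, rfl⟩
      · exact hc
      · rwa [show R a ∪ T ∪ R b = R b ∪ T ∪ R a by grind]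
    · exact h.connected a b hab
  center x := by
    obtain ⟨z, hz⟩ := h.center x
    refine ⟨z, fun a b hab hx => ?_⟩
    split_ifs at hx with hs
    · have := hz u v huv (hT hx)
      rcases Sym2.eq_iff.1 hs with ⟨rfl, rfl⟩ | ⟨rfl, rfl⟩
      · exact this
      · exact this.symm
    · exact hz a b hab hx

open Classical in
/-- Move a vertex all of whose edges are incident with `u` from the links to the root set of `u`. -/
lemma absorb (h : LinkScheme H G R S) {u v : α} {x : β} (huv : H.Adj u v) (hx : x ∈ S u v)
    (hadj : ∃ r ∈ R u, G.Adj r x) (hstar : ∀ a b, H.Adj a b → x ∈ S a b → u = a ∨ u = b) :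
    LinkScheme H G (Function.update R u (insert x (R u))) (fun a b => S a b \ {x}) where
  symm a b := by rw [h.symm a b]
  root_connected a := by
    by_cases ha : a = u
    · subst ha
      simpa using (h.root_connected a).insert hadj
    · simpa [ha] using h.root_connected a
  root_disjoint a b hab := by
    have hd := Set.disjoint_left.1 (h.root_disjoint hab)
    have hn := h.notMem_root u v huv x hx
    refine Set.disjoint_left.2 ?_
    by_cases ha : a = u
    · subst ha
      simp only [Function.update_self, Function.update_of_ne hab.symm]
      grind
    by_cases hb : b = u
    · subst hb
      simp only [Function.update_self, Function.update_of_ne hab]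
      grind
    simpa [ha, hb] using hd
  notMem_root a b hab y hy w := by
    have := h.notMem_root a b hab y hy.1 w
    have hyx : y ≠ x := hy.2
    by_cases hw : w = u
    · subst hw
      simp [this, hyx]
    · simpa [hw] using this
  connected a b hab := by
    have hc := h.connected a b hab
    by_cases ha : a = u
    · subst ha
      have := hc.insert (x := x) (by
        obtain ⟨r, hr, hrx⟩ := hadj
        exact ⟨r, by grind, hrx⟩)
      simp only [Function.update_self, Function.update_of_ne hab.ne']
      rwa [show insert x (R a) ∪ S a b \ {x} ∪ R b = insert x (R a ∪ S a b ∪ R b) by ext; grind]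
    by_cases hb : b = u
    · subst hb
      have := hc.insert (x := x) (by
        obtain ⟨r, hr, hrx⟩ := hadj
        exact ⟨r, by grind, hrx⟩)
      simp only [Function.update_self, Function.update_of_ne hab.ne]
      rwa [show R a ∪ S a b \ {x} ∪ insert x (R b) = insert x (R a ∪ S a b ∪ R b) by ext; grind]
    · have hxS : x ∉ S a b := fun hxS => by
        rcases hstar a b hab hxS with rfl | rfl <;> contradiction
      simpa [ha, hb, Set.sdiff_singleton_eq_self hxS] using hc
  center y := by
    obtain ⟨z, hz⟩ := h.center y
    exact ⟨z, fun a b hab hy => hz a b hab hy.1⟩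

/-- The linking sets are inclusion-minimal, and there are no edges between adjacent root sets. -/
def IsTight (H : SimpleGraph α) (G : SimpleGraph β) (R : α → Set β) (S : α → α → Set β) : Prop :=
  ∀ u v, H.Adj u v → IsMinimalLink G (R u) (S u v) (R v)

open Classical in
/-- Cut the link opposite to the apex of a pendant triangle in two and delete the triangle. -/
lemma exists_of_pendantTriangle [Finite α] [Finite β] (h : LinkScheme H G R S) (ht : IsTight H G R S) {u v w : α}
    (htri : IsPendantTriangle H u v w)
    (hfst : ∀ a b, H.Adj a b → ∃ x ∈ S a b, (∃ r ∈ R a, G.Adj r x) ∧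
      ∃ t, t ≠ a ∧ H.Adj b t ∧ x ∈ S b t) :
    ∃ H' : SimpleGraph α, ∃ R', H' ≤ H ∧ LinkScheme H' G R' S ∧ linkWeight H' S < linkWeight H S ∧
      (ExtendsToMinor H' G R' → ExtendsToMinor H G R) := by
  obtain ⟨huv, huw, hvw, hv, hw⟩ := htri
  have key : ∀ b c, H.Adj u b → (∀ x, H.Adj b x → x = u ∨ x = c) →
      ∃ x, x ∈ S u b ∧ x ∈ S b c ∧ ∃ r ∈ R u, G.Adj r x := by
    intro b c hub hb
    obtain ⟨x, hx, hr, t, htu, hbt, hxt⟩ := hfst u b hub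
    obtain rfl : t = c := (hb t hbt).resolve_left htu
    exact ⟨x, hx, hxt, hr⟩
  obtain ⟨x, hxu, hxv, hxr⟩ := key v w huv hv
  obtain ⟨y, hyu, hyw, hyr⟩ := key w v huw hw
  rw [h.symm] at hyw
  have hxy : x ≠ y := by
    rintro rfl
    obtain ⟨z, hz⟩ := h.center x
    have := hz _ _ huv hxu
    have := hz _ _ huw hyu
    have := hz _ _ hvw hxv
    have := huv.ne
    have := huw.ne
    have := hvw.ne
    grind
  obtain ⟨D, E, hRD, hRE, hD, hE, hDE, hDc, hEc, hDEadj, hsplit⟩ :=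
    (ht v w hvw).exists_split hxv hyw hxy
  let H' : SimpleGraph α :=
    { Adj := fun a b => H.Adj a b ∧ a ≠ v ∧ a ≠ w ∧ b ≠ v ∧ b ≠ w
      symm := ⟨fun a b hab => ⟨hab.1.symm, by tauto⟩⟩
      loopless := ⟨fun a ha => ha.1.ne rfl⟩ }
  have hle : H' ≤ H := fun a b hab => hab.1
  let R' : α → Set β := fun a => if a = v then D else if a = w then E else R a
  have hR'v : R' v = D := if_pos rfl
  have hR'w : R' w = E := by simp [R', hvw.ne']
  have hR' : ∀ a, a ≠ v → a ≠ w → R' a = R a := fun a h1 h2 => by simp [R', h1, h2]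
  have hdis : ∀ a, a ≠ v → a ≠ w → ∀ z ∈ R v ∪ S v w ∪ R w, z ∉ R a := by
    intro a hav haw z hz hza
    have h1 := Set.disjoint_left.1 (h.root_disjoint hav) hza
    have h2 := Set.disjoint_left.1 (h.root_disjoint haw) hza
    have h3 := h.notMem_root v w hvw z
    grind
  refine ⟨H', R', hle, ?_, weight_lt_of_edges hle hvw (fun hh => hh.2.1 rfl), ?_⟩
  · refine ⟨h.symm, ?_, ?_, ?_, ?_, (h.mono hle).center⟩
    · intro a
      by_cases hav : a = v
      · rwa [hav, hR'v]
      by_cases haw : a = w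
      · rwa [haw, hR'w]
      rw [hR' a hav haw]
      exact h.root_connected a
    · have : ∀ a b, a ≠ b → b ≠ v → b ≠ w → Disjoint (R' a) (R' b) := by
        intro a b hab hbv hbw
        rw [hR' b hbv hbw]
        by_cases hav : a = v
        · rw [hav, hR'v, Set.disjoint_left]
          exact fun z hz => hdis b hbv hbw z (hD hz)
        by_cases haw : a = w
        · rw [haw, hR'w, Set.disjoint_left]
          exact fun z hz => hdis b hbv hbw z (hE hz)
        rw [hR' a hav haw]
        exact h.root_disjoint hab
      intro a b hab
      by_cases hb : b ≠ v ∧ b ≠ w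
      · exact this a b hab hb.1 hb.2
      by_cases ha : a ≠ v ∧ a ≠ w
      · exact (this b a hab.symm ha.1 ha.2).symm
      have : (a = v ∧ b = w) ∨ (a = w ∧ b = v) := by grind
      rcases this with ⟨rfl, rfl⟩ | ⟨rfl, rfl⟩
      · rwa [hR'v, hR'w]
      · rw [hR'v, hR'w]
        exact hDE.symm
    · rintro a b ⟨hab, h1, h2, h3, h4⟩ z hz c hzc
      have hz' := h.notMem_root a b hab z hz
      have hzS : z ∉ S v w := by
        intro hzS
        obtain ⟨q, hq⟩ := h.center z
        have := hq _ _ hab hz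
        have := hq _ _ hvw hzS
        grind
      have := hz' v
      have := hz' w
      have := hz' c
      grind
    · rintro a b ⟨hab, h1, h2, h3, h4⟩
      rw [hR' a h1 h2, hR' b h3 h4]
      exact h.connected a b hab
  · intro hmin
    refine ExtendsToMinor.mono (R' := R') (hmin.of_le ?_) ?_
    · have hur : R' u = R u := hR' u huv.ne huw.ne
      have hadjv : ∃ p ∈ R' u, ∃ q ∈ R' v, G.Adj p q := by
        rw [hur, hR'v]
        obtain ⟨r, hr, hrx⟩ := hxr
        obtain ⟨r', hr', hry⟩ := hyr
        rcases hsplit with ⟨hh, -⟩ | ⟨hh, -⟩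
        · exact ⟨r, hr, x, hh, hrx⟩
        · exact ⟨r', hr', y, hh, hry⟩
      have hadjw : ∃ p ∈ R' u, ∃ q ∈ R' w, G.Adj p q := by
        rw [hur, hR'w]
        obtain ⟨r, hr, hrx⟩ := hxr
        obtain ⟨r', hr', hry⟩ := hyr
        rcases hsplit with ⟨-, hh⟩ | ⟨-, hh⟩
        · exact ⟨r', hr', y, hh, hry⟩
        · exact ⟨r, hr, x, hh, hrx⟩
      have hadjvw : ∃ p ∈ R' v, ∃ q ∈ R' w, G.Adj p q := by rwa [hR'v, hR'w]
      have swap : ∀ {a b}, (∃ p ∈ R' a, ∃ q ∈ R' b, G.Adj p q) →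
          ∃ p ∈ R' b, ∃ q ∈ R' a, G.Adj p q :=
        fun ⟨p, hp, q, hq, hpq⟩ => ⟨q, hq, p, hp, hpq.symm⟩
      intro a b hab
      by_cases hcase : a ≠ v ∧ a ≠ w ∧ b ≠ v ∧ b ≠ w
      · exact Or.inl ⟨hab, hcase⟩
      right
      by_cases hav : a = v
      · subst hav
        rcases hv b hab with rfl | rfl
        · exact swap hadjv
        · exact hadjvw
      by_cases haw : a = w
      · subst haw
        rcases hw b hab with rfl | rfl
        · exact swap hadjw
        · exact swap hadjvw
      by_cases hbv : b = v
      · subst hbv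
        rcases hv a hab.symm with rfl | rfl
        · exact hadjv
        · exact absurd rfl haw
      by_cases hbw : b = w
      · subst hbw
        rcases hw a hab.symm with rfl | rfl
        · exact hadjw
        · exact absurd rfl hav
      exact absurd ⟨hav, haw, hbv, hbw⟩ hcase
    · intro a
      by_cases hav : a = v
      · rwa [hav, hR'v]
      by_cases haw : a = w
      · rwa [haw, hR'w]
      rw [hR' a hav haw]

/-- Along a cyclic component, every root set can take over the first vertex of the link to its
successor, after which the links are rotated by one step. -/
lemma exists_of_cycleRotation [Finite α] [Finite β] (h : LinkScheme H G R S) (ht : IsTight H G R S) {σ : Equiv.Perm α}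
    (hσ : IsCycleRotation H σ) (hz : ∃ z, σ z ≠ z)
    (hfst : ∀ a b, H.Adj a b → ∃ x ∈ S a b, (∃ r ∈ R a, G.Adj r x) ∧
      ∃ t, t ≠ a ∧ H.Adj b t ∧ x ∈ S b t) :
    ∃ R' S', LinkScheme H G R' S' ∧ linkWeight H S' < linkWeight H S ∧ ∀ v, R v ⊆ R' v := by
  have hmove : ∀ u, σ u ≠ u → σ (σ u) ≠ σ u := fun u hu hh => hu (σ.injective hh)
  have key : ∀ u, σ u ≠ u → ∃ x, x ∈ S u (σ u) ∧ x ∈ S (σ u) (σ (σ u)) ∧ ∃ r ∈ R u, G.Adj r x := by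
    intro u hu
    obtain ⟨hadj, -, -⟩ := hσ u hu
    obtain ⟨x, hx, hr, t, htu, hbt, hxt⟩ := hfst u (σ u) hadj
    obtain rfl : t = σ (σ u) := by
      rcases (hσ (σ u) (hmove u hu)).2.2 t hbt with h1 | h1
      · exact h1
      · exact absurd (σ.injective h1).symm htu
    exact ⟨x, hx, hxt, hr⟩
  have : Nonempty β := (h.root_connected hz.choose).1.to_type
  choose! y hyu hyσ hyr using key
  have hcen : ∀ u, σ u ≠ u → ∀ a b, H.Adj a b → y u ∈ S a b → σ u = a ∨ σ u = b := by
    intro u hu a b hab hy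
    obtain ⟨z, hz⟩ := h.center (y u)
    have h1 := hz _ _ (hσ u hu).1 (hyu u hu)
    have h2 := hz _ _ (hσ _ (hmove u hu)).1 (hyσ u hu)
    have h3 := hz _ _ hab hy
    have := (hσ u hu).2.1
    grind
  have hinj : ∀ u v, σ u ≠ u → σ v ≠ v → y u = y v → u = v := by
    intro u v hu hv huv
    have h1 := hcen u hu _ _ (hσ v hv).1 (huv ▸ hyu v hv)
    have h2 := hcen u hu _ _ (hσ _ (hmove v hv)).1 (huv ▸ hyσ v hv)
    have := (hσ v hv).2.1
    have := hmove v hv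
    apply σ.injective
    grind
  have haut : ∀ u v, H.Adj u v → H.Adj (σ u) (σ v) := by
    have fwd : ∀ u, σ u ≠ u → H.Adj (σ u) (σ (σ u)) := fun u hu => (hσ _ (hmove u hu)).1
    intro u v huv
    by_cases hu : σ u = u
    · by_cases hv : σ v = v
      · rwa [hu, hv]
      · rcases (hσ v hv).2.2 u huv.symm with rfl | rfl
        · exact absurd (σ.injective hu) hv
        · exact absurd hu (by simpa using hv)
    · rcases (hσ u hu).2.2 v huv with rfl | rfl
      · exact fwd _ hu
      · exact (fwd _ (fun hh => hu (by rw [hh, hh]))).symm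
  let Y : Set β := {x | ∃ u, σ u ≠ u ∧ y u = x}
  let R' : α → Set β := fun u => R u ∪ {x | σ u ≠ u ∧ y u = x}
  have hR'moved : ∀ u, σ u ≠ u → R' u = insert (y u) (R u) := by
    intro u hu
    ext x
    simp only [R']
    grind
  have hR'fixed : ∀ u, σ u = u → R' u = R u := by
    intro u hu
    simp [R', hu]
  have hlink : ∀ u, σ u ≠ u → CutConnected G (R' u ∪ S (σ u) (σ (σ u)) \ Y ∪ R' (σ u)) := by
    intro u hu
    have hu' := hmove u hu
    have hyy := hyu (σ u) hu'
    have h1 : CutConnected G (R (σ u) ∪ S (σ u) (σ (σ u))) :=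
      (ht _ _ (hσ _ hu').1).connected_union_left
    have h2 : CutConnected G (R (σ u) ∪ S (σ u) (σ (σ u)) ∪ R u) := by
      refine h1.union (h.root_connected u) ?_
      obtain ⟨r, hr, hrx⟩ := hyr u hu
      exact ⟨y u, Or.inr (hyσ u hu), r, hr, Or.inr hrx.symm⟩
    rw [hR'moved u hu, hR'moved _ hu']
    convert h2 using 1
    ext x
    have hY : x ∈ Y → x ∈ S (σ u) (σ (σ u)) → x = y u ∨ x = y (σ u) := by
      rintro ⟨v, hv, rfl⟩ hx
      rcases hcen v hv _ _ (hσ _ hu').1 hx with h3 | h3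
      · rw [σ.injective h3]; exact Or.inl rfl
      · rw [σ.injective h3]; exact Or.inr rfl
    have := hyσ u hu
    simp only [Set.mem_union, Set.mem_insert_iff, Set.mem_sdiff]
    grind
  refine ⟨R', fun a b => S (σ a) (σ b) \ Y, ⟨?_, ?_, ?_, ?_, ?_, ?_⟩, ?_, fun v => Set.subset_union_left⟩
  · intro a b
    rw [h.symm]
  · intro a
    by_cases ha : σ a = a
    · rw [hR'fixed a ha]
      exact h.root_connected a
    · rw [hR'moved a ha]
      exact (h.root_connected a).insert (hyr a ha)
  · intro a b hab
    rw [Set.disjoint_left]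
    have hd := Set.disjoint_left.1 (h.root_disjoint hab)
    rintro x (hxa | ⟨ha, rfl⟩) (hxb | ⟨hb, hyb⟩)
    · exact hd hxa hxb
    · exact h.notMem_root _ _ (hσ b hb).1 _ (hyu b hb) a (hyb ▸ hxa)
    · exact h.notMem_root _ _ (hσ a ha).1 _ (hyu a ha) b hxb
    · exact hab (hinj b a hb ha hyb).symm
  · rintro a b hab x ⟨hx, hxY⟩ w (hxw | ⟨hw, rfl⟩)
    · exact h.notMem_root _ _ (haut a b hab) x hx w hxw
    · exact hxY ⟨w, hw, rfl⟩
  · intro a b hab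
    by_cases ha : σ a = a
    · by_cases hb : σ b = b
      · have : S a b \ Y = S a b := by
          rw [sdiff_eq_left, Set.disjoint_left]
          rintro x hx ⟨u, hu, rfl⟩
          have := hmove u hu
          rcases hcen u hu _ _ hab hx with rfl | rfl <;> contradiction
        simp only [ha, hb, this, hR'fixed]
        exact h.connected a b hab
      · rcases (hσ b hb).2.2 a hab.symm with rfl | rfl
        · exact absurd (σ.injective ha) hb
        · exact absurd ha (by simpa using hb)
    · rcases (hσ a ha).2.2 b hab with rfl | rfl
      · exact hlink a ha
      · have := hlink b (fun hh => ha (by rw [hh, hh]))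
        rw [h.symm]
        rwa [show ∀ A B C : Set β, A ∪ B ∪ C = C ∪ B ∪ A by grind]
  · intro x
    obtain ⟨z, hz⟩ := h.center x
    refine ⟨σ.symm z, fun a b hab hx => ?_⟩
    rw [Equiv.symm_apply_eq, Equiv.symm_apply_eq]
    exact hz _ _ (haut a b hab) hx.1
  · rw [← weight_perm (S := S) σ]
    obtain ⟨z, hz⟩ := hz
    exact weight_lt_of_links (fun u v => Set.sdiff_subset) (hyσ z hz) (fun hh => hh.2 ⟨z, hz, rfl⟩)

theorem extendsToMinor [Finite α] [Finite β] (hH : ThinCycles H) (h : LinkScheme H G R S) : ExtendsToMinor H G R := by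
  classical
  induction hn : linkWeight H S using Nat.strong_induction_on generalizing H R S with
  | _ n ih =>
  subst hn
  by_contra hcon
  have hadj : ∀ u v, H.Adj u v → ∀ a ∈ R u, ∀ b ∈ R v, ¬ G.Adj a b := by
    intro u v huv a ha b hb hab
    have hle := H.deleteEdges_le {s(u, v)}
    refine hcon ((ih _ (weight_lt_of_edges hle huv (by simp)) (hH.mono hle) (h.mono hle) rfl).of_le ?_)
    intro c d hcd
    by_cases hs : s(c, d) = s(u, v)
    · right
      rcases Sym2.eq_iff.1 hs with ⟨rfl, rfl⟩ | ⟨rfl, rfl⟩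
      · exact ⟨a, ha, b, hb, hab⟩
      · exact ⟨b, hb, a, ha, hab.symm⟩
    · left
      rw [deleteEdges_adj]
      exact ⟨hcd, hs⟩
  have hmin : ∀ u v, H.Adj u v → ∀ T ⊆ S u v, CutConnected G (R u ∪ T ∪ R v) → T = S u v := by
    intro u v huv T hT hc
    by_contra hne
    obtain ⟨x, hx, hxT⟩ := Set.exists_of_ssubset (hT.ssubset_of_ne hne)
    refine hcon (ih _ (weight_lt_of_links (u := u) (v := v) (x := x) ?_ hx ?_) hH
      (h.shrink huv hT hc) rfl)
    · intro a b
      split_ifs with hs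
      · rcases Sym2.eq_iff.1 hs with ⟨rfl, rfl⟩ | ⟨rfl, rfl⟩
        · exact hT
        · rwa [h.symm]
      · exact subset_rfl
    · simpa using hxT
  have ht : IsTight H G R S := fun u v huv =>
    { left := h.root_connected u
      right := h.root_connected v
      disjoint := h.root_disjoint huv.ne
      disjoint_left := Set.disjoint_left.2 fun x hx => h.notMem_root u v huv x hx u
      disjoint_right := Set.disjoint_left.2 fun x hx => h.notMem_root u v huv x hx v
      connected := h.connected u v huv
      minimal := hmin u v huv
      not_adj := hadj u v huv }
  have hfst : ∀ a b, H.Adj a b → ∃ x ∈ S a b, (∃ r ∈ R a, G.Adj r x) ∧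
      ∃ t, t ≠ a ∧ H.Adj b t ∧ x ∈ S b t := by
    intro a b hab
    obtain ⟨x, hx, hr⟩ := (ht a b hab).exists_adj_left
    refine ⟨x, hx, hr, ?_⟩
    by_contra! hno
    have hstar : ∀ c d, H.Adj c d → x ∈ S c d → a = c ∨ a = d := by
      intro c d hcd hxc
      obtain ⟨z, hz⟩ := h.center x
      have h1 := hz _ _ hab hx
      have h2 := hz _ _ hcd hxc
      by_contra! hne
      rcases h1 with rfl | rfl
      · grind
      · rcases h2 with rfl | rfl
        · exact hno d hne.2.symm hcd hxc
        · exact hno c hne.1.symm hcd.symm (h.symm c z ▸ hxc)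
    refine hcon ((ih _ (weight_lt_of_links (fun _ _ => Set.sdiff_subset) hx (by simp)) hH
      (h.absorb hab hx hr hstar) rfl).mono ?_)
    intro c
    by_cases hc : c = a
    · subst hc; simp
    · simp [hc]
  by_cases hne : ∃ u v, H.Adj u v
  · have hdeg : ∀ u v, H.Adj u v → ∃ t, t ≠ u ∧ H.Adj v t := by
      intro u v huv
      obtain ⟨x, -, -, t, htu, hvt, -⟩ := hfst u v huv
      exact ⟨t, htu, hvt⟩
    rcases exists_pendantTriangle_or_cycleRotation hH hdeg hne with ⟨u, v, w, htri⟩ | ⟨σ, hσ, hz⟩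
    · obtain ⟨H', R', hle, h', hlt, himp⟩ := h.exists_of_pendantTriangle ht htri hfst
      exact hcon (himp (ih _ hlt (hH.mono hle) h' rfl))
    · obtain ⟨R', S', h', hlt, hR⟩ := h.exists_of_cycleRotation ht hσ hz hfst
      exact hcon ((ih _ hlt hH h' rfl).mono hR)
  · exact hcon ⟨R, fun _ => subset_rfl, h.root_connected, h.root_disjoint,
      fun u v huv => absurd ⟨u, v, huv⟩ hne⟩

end LinkScheme

lemma HScheme.linkScheme {α β : Type} [Nonempty α] {H : SimpleGraph α} {G : SimpleGraph β}
    {f : α ↪ β} (P : HScheme H G f) :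
    LinkScheme H G (fun v => {f v})
      (fun u v => {x | x ∉ Set.range f ∧ ∃ h : H.Adj u v, x ∈ (P.path u v h).support}) where
  symm := by
    have : ∀ u v (x : β), (∃ h : H.Adj u v, x ∈ (P.path u v h).support) →
        ∃ h : H.Adj v u, x ∈ (P.path v u h).support := by
      rintro u v x ⟨h, hx⟩
      refine ⟨h.symm, ?_⟩
      rw [P.path_symm u v h]
      simpa using hx
    intro u v
    ext x
    exact and_congr_right fun _ => ⟨this u v x, this v u x⟩
  root_connected v := CutConnected.singleton G (f v)
  root_disjoint u v huv := by simpa using fun h => huv (f.injective h)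
  notMem_root u v _ x hx w hxw := hx.1 ⟨w, hxw.symm⟩
  connected u v huv := by
    have : {f u} ∪ {x | x ∉ Set.range f ∧ ∃ h : H.Adj u v, x ∈ (P.path u v h).support} ∪ {f v} =
        {x | x ∈ (P.path u v huv).support} := by
      ext x
      simp only [Set.mem_union, Set.mem_singleton_iff, Set.mem_ofPred_eq]
      constructor
      · rintro ((rfl | ⟨_, _, hx⟩) | rfl)
        · exact Walk.start_mem_support _
        · exact hx
        · exact Walk.end_mem_support _
      · intro hx
        by_cases hxf : x ∈ Set.range f
        · obtain ⟨w, rfl⟩ := hxf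
          rcases P.root_mem u v huv w hx with rfl | rfl <;> simp
        · exact Or.inl (Or.inr ⟨hxf, huv, hx⟩)
    rw [this, CutConnected.iff_induce_connected]
    exact Walk.connected_induce_support _
  center x := by
    by_cases hx : ∃ u v, ∃ h : H.Adj u v, x ∈ (P.path u v h).support
    · obtain ⟨z, hz⟩ := P.common_endpoint x hx
      exact ⟨z, fun u v _ ⟨_, h, hx⟩ => hz u v h hx⟩
    · exact ⟨Classical.arbitrary α, fun u v _ ⟨_, h, hx'⟩ => absurd ⟨u, v, h, hx'⟩ hx⟩

/-- A cactus in which at most one cycle has more than 3 vertices is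
rooted-contractible. -/
theorem cactus_one_long_cycle_rooted_contractible {α : Type} [Fintype α]
    (H : SimpleGraph α) (hc : IsCactus H)
    (hone : ∀ (u v : α) (c₁ : H.Walk u u) (c₂ : H.Walk v v),
      c₁.IsCycle → c₂.IsCycle → 3 < c₁.length → 3 < c₂.length →
      {e | e ∈ c₁.edges} = {e | e ∈ c₂.edges}) :
    IsRootedContractible H := by
  rintro β _ G f ⟨P⟩
  have := hc.1.nonempty
  obtain ⟨C, h1, h2, h3, h4⟩ := P.linkScheme.extendsToMinor ⟨hc.2, hone⟩
  exact ⟨C, fun v => h1 v rfl, fun v => CutConnected.iff_induce_connected.1 (h2 v), h3, h4⟩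
end
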